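/- For every T ∈ (0, ∞) there exists a constant C_T > 0 with the following property. Let ρ : ℝ² → ℝ be twice continuously differentiable with bounded first and second derivatives, and let u, v be Schwartz-regular solutions of the linear equation i ∂ₜw − Δw + |x|² w = 0. For t ∈ ℝ and x, y ∈ ℝ² set a(t,x,y) := conj(v(t,y)) ∇_x u(t,x) + u(t,x) ∇_y conj(v(t,y)) ∈ ℂ². Then ∫₀^T ∫_{ℝ²} ∫_{ℝ²} Σ_{k,l=1}^{2} ∂²_{kl} ρ(x−y) · a_k(t,x,y) · conj( a_l(t,x,y) ) dx dy dt ≤ C_T ‖∇ρ‖_{L^∞} ( ‖v(0)‖²_{L²} ‖u(0)‖_{L²} ‖u(0)‖_{ℋ¹} + ‖u(0)‖²_{L²} ‖v(0)‖_{L²} ‖v(0)‖_{ℋ¹} ). -/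

import Mathlib

open MeasureTheory Complex

noncomputable section

abbrev E2 : Type := EuclideanSpace ℝ (Fin 2)

/-- Partial derivative in the `i`-th coordinate direction. -/
noncomputable def pd (i : Fin 2) (f : E2 → ℂ) : E2 → ℂ :=
  fun x => fderiv ℝ f x (EuclideanSpace.single i 1)

/-- The Laplacian on `ℝ²`. -/
noncomputable def lap (f : E2 → ℂ) : E2 → ℂ :=
  fun x => ∑ i : Fin 2, pd i (pd i f) x

/-- The harmonic oscillator `A f = -Δ f + |x|² f`. -/
noncomputable def Aop (f : E2 → ℂ) : E2 → ℂ :=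
  fun x => -lap f x + (‖x‖ : ℂ)^2 * f x

/-- Time derivative of a time-dependent function. -/
noncomputable def tderiv (F : ℝ → E2 → ℂ) : ℝ → E2 → ℂ :=
  fun t x => deriv (fun s => F s x) t

/-- Squared euclidean norm of the gradient, `|∇f|²(x)`. -/
noncomputable def gradSq (f : E2 → ℂ) (x : E2) : ℝ := ∑ i : Fin 2, ‖pd i f x‖^2

/-- The `L²` norm. -/
noncomputable def L2norm (f : E2 → ℂ) : ℝ := Real.sqrt (∫ x : E2, ‖f x‖^2)

/-- The `ℋ¹` norm: `(‖∇φ‖² + ‖|x|φ‖²)^(1/2)`. -/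
noncomputable def H1norm (f : E2 → ℂ) : ℝ :=
  Real.sqrt ((∫ x : E2, gradSq f x) + ∫ x : E2, ‖x‖^2 * ‖f x‖^2)

/-- A Schwartz-regular solution of the cubic NLS with harmonic potential,
`i ∂ₜ u - Δu + |x|² u + σ u |u|² = 0`. -/
def IsSolution (σ : ℝ) (u : ℝ → SchwartzMap E2 ℂ) : Prop :=
  ContDiff ℝ (⊤ : ℕ∞) (fun p : ℝ × E2 => u p.1 p.2) ∧
  ∀ (t : ℝ) (x : E2), Complex.I * deriv (fun s => u s x) t - lap (fun y => u t y) x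
    + (‖x‖ : ℂ)^2 * u t x + (σ : ℂ) * u t x * (‖u t x‖ : ℂ)^2 = 0

/-- A Schwartz-regular solution of the linear Schrödinger equation with harmonic
potential, `i ∂ₜ w - Δw + |x|² w = 0`. -/
def IsLinSolution (w : ℝ → SchwartzMap E2 ℂ) : Prop :=
  ContDiff ℝ (⊤ : ℕ∞) (fun p : ℝ × E2 => w p.1 p.2) ∧
  ∀ (t : ℝ) (x : E2), Complex.I * deriv (fun s => w s x) t - lap (fun y => w t y) x
    + (‖x‖ : ℂ)^2 * w t x = 0

/-- Partial derivative for real-valued functions. -/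
noncomputable def pdR (i : Fin 2) (f : E2 → ℝ) : E2 → ℝ :=
  fun x => fderiv ℝ f x (EuclideanSpace.single i 1)

/-- The Laplacian for real-valued functions. -/
noncomputable def lapR (f : E2 → ℝ) : E2 → ℝ :=
  fun x => ∑ i : Fin 2, pdR i (pdR i f) x

section Virial

open scoped FourierTransform SchwartzMap ENNReal ContDiff LineDeriv
open Filter Topology

theorem hasTemperateGrowth_gaussian :
    Function.HasTemperateGrowth (fun x : E2 => Real.exp (-(‖x‖ ^ 2 / 2))) := by
  have hcomp : (fun x : E2 => Real.exp (-(‖x‖ ^ 2 / 2)))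
      = (fun s : ℝ => Real.exp (-(1 / 2 : ℝ) * s)) ∘ (fun x : E2 => ‖x‖ ^ 2) := by
    funext x; simp only [Function.comp]; congr 1; ring
  rw [hcomp]
  have hderiv : ∀ n : ℕ, iteratedDeriv n (fun s : ℝ => Real.exp (-(1 / 2 : ℝ) * s))
      = fun s => (-(1 / 2 : ℝ)) ^ n * Real.exp (-(1 / 2 : ℝ) * s) := by
    intro n
    exact iteratedDeriv_exp_const_mul n (-(1 / 2 : ℝ))
  have hsm : ContDiff ℝ ⊤ (fun s : ℝ => Real.exp (-(1 / 2 : ℝ) * s)) := by fun_prop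
  refine Function.HasTemperateGrowth.comp' (t := Set.Ici (0 : ℝ)) ?_ (uniqueDiffOn_Ici 0)
    (hsm.of_le le_top).contDiffOn ?_ (Function.hasTemperateGrowth_norm_sq E2)
  · rintro _ ⟨x, rfl⟩
    simp only [Set.mem_Ici]; positivity
  · intro N
    refine ⟨0, 1, zero_le_one, fun n _ x hx => ?_⟩
    rw [iteratedFDerivWithin_eq_iteratedFDeriv (uniqueDiffOn_Ici 0)
      ((hsm.of_le le_top).contDiffAt) hx, norm_iteratedFDeriv_eq_norm_iteratedDeriv, hderiv]
    simp only [norm_mul, norm_pow, norm_neg, Real.norm_eq_abs, Real.abs_exp, pow_zero, mul_one]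
    have h1 : |(1 / 2 : ℝ)| ^ n ≤ 1 := pow_le_one₀ (abs_nonneg _) (by rw [abs_of_pos] <;> norm_num)
    have hx' : 0 ≤ x := hx
    have h2 : Real.exp (-(1 / 2 : ℝ) * x) ≤ 1 := Real.exp_le_one_iff.2 (by linarith)
    calc _ ≤ (1 : ℝ) * 1 := by gcongr
      _ = 1 := one_mul 1

theorem hasTemperateGrowth_gaussian_sub (a : E2) :
    Function.HasTemperateGrowth (fun x : E2 => ((Real.exp (-(‖x - a‖ ^ 2 / 2)) : ℝ) : ℂ)) := by
  have h : Function.HasTemperateGrowth (fun x : E2 => x - a) :=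
    Function.HasTemperateGrowth.id'.sub (Function.HasTemperateGrowth.const a)
  exact Function.Complex.hasTemperateGrowth_ofReal.comp (hasTemperateGrowth_gaussian.comp h)

/-- The coherent state `exp (-|x|²/2 + ζ·x - ζ·ζ/4)` with complex parameter `ζ`. -/
def cohState (z : Fin 2 → ℂ) (x : E2) : ℂ :=
  Complex.exp (-((‖x‖ ^ 2 : ℝ) : ℂ) / 2 + ∑ i, z i * (x i : ℂ) - (∑ i, z i ^ 2) / 4)

/-- The complex vector with real part `p.1` and imaginary part `p.2`. -/
def cvec (p : E2 × E2) : Fin 2 → ℂ := fun i => (p.1 i : ℂ) + (p.2 i : ℂ) * I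

/-- Plancherel's theorem with the kernel `exp (i b·x)`. -/
theorem lintegral_enorm_sq_fourier_scaled (g : 𝓢(E2, ℂ)) :
    ∫⁻ b : E2, ‖∫ x, Complex.exp (((∑ i, b i * x i : ℝ) : ℂ) * I) * g x‖ₑ ^ 2
      = ENNReal.ofReal ((2 * Real.pi) ^ 2) * ∫⁻ x, ‖g x‖ₑ ^ 2 := by
  have hpi := Real.pi_pos
  have key : ∀ b : E2, ∫ x, Complex.exp (((∑ i, b i * x i : ℝ) : ℂ) * I) * g x
      = 𝓕 g ((-(2 * Real.pi)⁻¹ : ℝ) • b) := by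
    intro b
    rw [SchwartzMap.fourier_coe, Real.fourier_eq]
    congr 1; funext x
    rw [Circle.smul_def, Real.fourierChar_apply, smul_eq_mul]
    congr 3
    rw [inner_smul_right, PiLp.inner_apply]
    simp only [Fin.sum_univ_two, RCLike.inner_apply, conj_trivial]
    push_cast
    field_simp
  simp_rw [key]
  have hinteg : ∀ h : 𝓢(E2, ℂ), Integrable (fun x => ‖h x‖ ^ 2) := fun h =>
    (h.memLp 2 volume).integrable_norm_pow (by norm_num)
  have hconv : ∀ h : E2 → ℂ, Integrable (fun x => ‖h x‖ ^ 2) →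
      ∫⁻ x, ‖h x‖ₑ ^ 2 = ENNReal.ofReal (∫ x, ‖h x‖ ^ 2) := by
    intro h hh
    rw [ofReal_integral_eq_lintegral_ofReal hh (ae_of_all _ fun x => by positivity)]
    congr 1; funext x
    rw [ENNReal.ofReal_pow (norm_nonneg _), ofReal_norm]
  have hne : (-(2 * Real.pi)⁻¹ : ℝ) ≠ 0 := by
    apply neg_ne_zero.2; positivity
  rw [hconv (fun b => 𝓕 g ((-(2 * Real.pi)⁻¹ : ℝ) • b)) ((hinteg (𝓕 g)).comp_smul hne), hconv _ (hinteg g),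
    ← ENNReal.ofReal_mul (by positivity)]
  congr 1
  rw [Measure.integral_comp_smul volume (fun b => ‖𝓕 g b‖ ^ 2), SchwartzMap.integral_norm_sq_fourier]
  simp only [finrank_euclideanSpace, Fintype.card_fin, smul_eq_mul]
  congr 1
  rw [neg_sq, inv_pow, inv_inv, abs_of_pos (by positivity)]

/-- The mass constant in the Bargmann isometry. -/
def bargConst : ℝ≥0∞ :=
  ENNReal.ofReal ((2 * Real.pi) ^ 2) * ∫⁻ a : E2, ENNReal.ofReal (Real.exp (-‖a‖ ^ 2))

theorem bargConst_ne_zero : bargConst ≠ 0 := by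
  unfold bargConst
  refine mul_ne_zero (ne_of_gt (ENNReal.ofReal_pos.2 (by positivity))) ?_
  rw [← ofReal_integral_eq_lintegral_ofReal _ (ae_of_all _ fun x => by positivity)]
  · have := GaussianFourier.integral_rexp_neg_mul_sq_norm (V := E2) (b := 1) one_pos
    simp only [neg_one_mul] at this
    simp only [ne_eq, ENNReal.ofReal_eq_zero, not_le]
    rw [this]; positivity
  · have := GaussianFourier.integrable_cexp_neg_mul_sq_norm_add (V := E2) (b := 1) (by simp) 0 0
    have := this.norm
    refine this.congr (ae_of_all _ fun x => ?_)
    simp only [Complex.norm_exp]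
    congr 1
    simp [← ofReal_pow]

theorem bargConst_ne_top : bargConst ≠ ⊤ := by
  unfold bargConst
  refine ENNReal.mul_ne_top ENNReal.ofReal_ne_top ?_
  rw [← ofReal_integral_eq_lintegral_ofReal _ (ae_of_all _ fun x => by positivity)]
  · exact ENNReal.ofReal_ne_top
  · have := GaussianFourier.integrable_cexp_neg_mul_sq_norm_add (V := E2) (b := 1) (by simp) 0 0
    have := this.norm
    refine this.congr (ae_of_all _ fun x => ?_)
    simp only [Complex.norm_exp]
    congr 1
    simp [← ofReal_pow]

/-- The density whose integral over phase space is the squared Bargmann norm. -/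
def bargDensity (f : E2 → ℂ) (p : E2 × E2) : ℝ≥0∞ :=
  ‖∫ x, f x * cohState (cvec p) x‖ₑ ^ 2
    * ENNReal.ofReal (Real.exp (-(‖p.1‖ ^ 2 + ‖p.2‖ ^ 2) / 2))

theorem norm_sq_E2 (x : E2) : ‖x‖ ^ 2 = x 0 ^ 2 + x 1 ^ 2 := by
  rw [EuclideanSpace.norm_sq_eq]; simp

theorem measurable_bargDensity (f : 𝓢(E2, ℂ)) : Measurable (bargDensity f) := by
  have hcont : Continuous (Function.uncurry fun (p : E2 × E2) (x : E2) =>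
      f x * cohState (cvec p) x) := by
    have h1 : Continuous fun q : (E2 × E2) × E2 => cohState (cvec q.1) q.2 := by
      unfold cohState cvec
      fun_prop
    exact (f.continuous.comp continuous_snd).mul h1
  have hI : Measurable fun p : E2 × E2 => ∫ x, f x * cohState (cvec p) x :=
    (hcont.stronglyMeasurable.integral_prod_right (ν := (volume : Measure E2))).measurable
  have hw : Measurable fun p : E2 × E2 =>
      ENNReal.ofReal (Real.exp (-(‖p.1‖ ^ 2 + ‖p.2‖ ^ 2) / 2)) := by fun_prop
  exact (hI.enorm.pow_const 2).mul hw

theorem bargDensity_eq (f : E2 → ℂ) (a b : E2) :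
    bargDensity f (a, b) = ‖∫ x, Complex.exp (((∑ i, b i * x i : ℝ) : ℂ) * I)
      * (((Real.exp (-(‖x - a‖ ^ 2 / 2)) : ℝ) : ℂ) * f x)‖ₑ ^ 2 := by
  unfold bargDensity
  set A : ℂ := Complex.exp (((‖a‖ ^ 2 : ℝ) : ℂ) / 2 - (∑ i, cvec (a, b) i ^ 2) / 4) with hA
  have h1 : ∀ x, f x * cohState (cvec (a, b)) x = A *
      (Complex.exp (((∑ i, b i * x i : ℝ) : ℂ) * I)
        * (((Real.exp (-(‖x - a‖ ^ 2 / 2)) : ℝ) : ℂ) * f x)) := by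
    intro x
    have : cohState (cvec (a, b)) x = A * Complex.exp (((∑ i, b i * x i : ℝ) : ℂ) * I)
        * ((Real.exp (-(‖x - a‖ ^ 2 / 2)) : ℝ) : ℂ) := by
      rw [hA, cohState, Complex.ofReal_exp, ← Complex.exp_add, ← Complex.exp_add]
      congr 1
      rw [norm_sq_E2, norm_sq_E2, norm_sq_E2]
      simp only [cvec, Fin.sum_univ_two, PiLp.sub_apply]
      push_cast
      ring
    rw [this]; ring
  simp_rw [h1]
  rw [integral_const_mul, enorm_mul, mul_pow]
  have h2 : ‖A‖ₑ ^ 2 * ENNReal.ofReal (Real.exp (-(‖a‖ ^ 2 + ‖b‖ ^ 2) / 2)) = 1 := by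
    rw [← ofReal_norm, ← ENNReal.ofReal_pow (norm_nonneg _), ← ENNReal.ofReal_mul (by positivity),
      hA, Complex.norm_exp, ← Real.exp_nat_mul, ← Real.exp_add]
    rw [← ENNReal.ofReal_one, ← Real.exp_zero]
    congr 2
    rw [norm_sq_E2, norm_sq_E2]
    simp only [cvec, Fin.sum_univ_two]
    have : (((a 0 ^ 2 + a 1 ^ 2 : ℝ) : ℂ) / 2 - (((a 0 : ℂ) + (b 0 : ℂ) * I) ^ 2
        + ((a 1 : ℂ) + (b 1 : ℂ) * I) ^ 2) / 4).re
        = (a 0 ^ 2 + a 1 ^ 2) / 2 - (a 0 ^ 2 - b 0 ^ 2 + a 1 ^ 2 - b 1 ^ 2) / 4 := by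
      have e : (((a 0 ^ 2 + a 1 ^ 2 : ℝ) : ℂ) / 2 - (((a 0 : ℂ) + (b 0 : ℂ) * I) ^ 2
        + ((a 1 : ℂ) + (b 1 : ℂ) * I) ^ 2) / 4)
        = (((a 0 ^ 2 + a 1 ^ 2) / 2 - (a 0 ^ 2 - b 0 ^ 2 + a 1 ^ 2 - b 1 ^ 2) / 4 : ℝ) : ℂ)
          + ((-(a 0 * b 0 + a 1 * b 1) / 2 : ℝ) : ℂ) * I := by
        push_cast
        linear_combination (-((b 0 : ℂ) ^ 2 + (b 1 : ℂ) ^ 2) / 4) * I_sq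
      rw [e, Complex.add_re, Complex.ofReal_re, Complex.re_ofReal_mul, Complex.I_re, mul_zero, add_zero]
    rw [this]; push_cast; ring
  calc _ = (‖A‖ₑ ^ 2 * ENNReal.ofReal (Real.exp (-(‖a‖ ^ 2 + ‖b‖ ^ 2) / 2))) * _ := by
        rw [mul_right_comm]
    _ = _ := by rw [h2, one_mul]

/-- The Bargmann transform is an isometry up to a constant. -/
theorem lintegral_bargDensity (f : 𝓢(E2, ℂ)) :
    ∫⁻ p, bargDensity f p = bargConst * ∫⁻ x, ‖f x‖ₑ ^ 2 := by
  rw [Measure.volume_eq_prod, lintegral_prod _ (measurable_bargDensity f).aemeasurable]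
  simp_rw [bargDensity_eq]
  have h1 : ∀ a : E2, ∫⁻ b : E2, ‖∫ x, Complex.exp (((∑ i, b i * x i : ℝ) : ℂ) * I)
      * (((Real.exp (-(‖x - a‖ ^ 2 / 2)) : ℝ) : ℂ) * f x)‖ₑ ^ 2
      = ENNReal.ofReal ((2 * Real.pi) ^ 2)
        * ∫⁻ x, ENNReal.ofReal (Real.exp (-‖x - a‖ ^ 2)) * ‖f x‖ₑ ^ 2 := by
    intro a
    have := lintegral_enorm_sq_fourier_scaled (SchwartzMap.smulLeftCLM ℂ
      (fun x : E2 => ((Real.exp (-(‖x - a‖ ^ 2 / 2)) : ℝ) : ℂ)) f)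
    simp only [SchwartzMap.smulLeftCLM_apply_apply (hasTemperateGrowth_gaussian_sub a),
      smul_eq_mul] at this
    rw [this]
    congr 2; funext x
    rw [enorm_mul, mul_pow]
    congr 1
    rw [← ofReal_norm, ← ENNReal.ofReal_pow (norm_nonneg _), Complex.norm_real,
      Real.norm_of_nonneg (Real.exp_pos _).le, ← Real.exp_nat_mul]
    congr 2; push_cast; ring
  simp_rw [h1]
  have hmeas : Measurable (Function.uncurry fun (a x : E2) =>
      ENNReal.ofReal (Real.exp (-‖x - a‖ ^ 2)) * ‖f x‖ₑ ^ 2) := by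
    have ha : Measurable fun q : E2 × E2 => ENNReal.ofReal (Real.exp (-‖q.2 - q.1‖ ^ 2)) := by
      fun_prop
    exact ha.mul ((f.continuous.measurable.comp measurable_snd).enorm.pow_const 2)
  rw [lintegral_const_mul _ (by
    exact Measurable.lintegral_prod_right hmeas)]
  rw [lintegral_lintegral_swap (by
    exact hmeas.aemeasurable)]
  have h2 : ∀ x : E2, ∫⁻ a : E2, ENNReal.ofReal (Real.exp (-‖x - a‖ ^ 2)) * ‖f x‖ₑ ^ 2
      = (∫⁻ a : E2, ENNReal.ofReal (Real.exp (-‖a‖ ^ 2))) * ‖f x‖ₑ ^ 2 := by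
    intro x
    rw [lintegral_mul_const _ (by fun_prop)]
    congr 1
    exact lintegral_sub_left_eq_self (fun a : E2 => ENNReal.ofReal (Real.exp (-‖a‖ ^ 2))) x
  simp_rw [h2]
  rw [lintegral_const_mul _ (by
    have : Continuous (fun x => f x) := f.continuous
    fun_prop), bargConst, mul_assoc]

/-- The rotation by angle `θ` mixing the two factors of phase space. -/
def phaseRot (θ : ℝ) (p : E2 × E2) : E2 × E2 :=
  (Real.cos θ • p.1 - Real.sin θ • p.2, Real.sin θ • p.1 + Real.cos θ • p.2)

theorem phaseRot_norm (θ : ℝ) (p : E2 × E2) :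
    ‖(phaseRot θ p).1‖ ^ 2 + ‖(phaseRot θ p).2‖ ^ 2 = ‖p.1‖ ^ 2 + ‖p.2‖ ^ 2 := by
  simp only [norm_sq_E2, phaseRot, PiLp.sub_apply, PiLp.add_apply, PiLp.smul_apply, smul_eq_mul]
  linear_combination (p.1 0 ^ 2 + p.1 1 ^ 2 + p.2 0 ^ 2 + p.2 1 ^ 2) * Real.sin_sq_add_cos_sq θ

theorem cvec_phaseRot (θ : ℝ) (p : E2 × E2) :
    cvec (phaseRot θ p) = fun i => Complex.exp (θ * I) * cvec p i := by
  funext i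
  rw [Complex.exp_mul_I]
  simp only [cvec, phaseRot, PiLp.sub_apply, PiLp.add_apply, PiLp.smul_apply, smul_eq_mul]
  push_cast
  linear_combination (-Complex.sin θ * p.2 i) * I_sq

theorem phaseRot_comp (θ : ℝ) (p : E2 × E2) : phaseRot θ (phaseRot (-θ) p) = p := by
  ext i
  all_goals
    simp only [phaseRot, PiLp.sub_apply, PiLp.add_apply, PiLp.smul_apply, smul_eq_mul,
      Real.cos_neg, Real.sin_neg]
  · linear_combination p.1 i * Real.sin_sq_add_cos_sq θ
  · linear_combination p.2 i * Real.sin_sq_add_cos_sq θ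

/-- Phase space rotations as linear isometries of the Hilbert sum. -/
def phaseRotIso (θ : ℝ) : WithLp 2 (E2 × E2) ≃ₗᵢ[ℝ] WithLp 2 (E2 × E2) where
  toFun p := WithLp.toLp 2 (phaseRot θ (WithLp.ofLp p))
  invFun p := WithLp.toLp 2 (phaseRot (-θ) (WithLp.ofLp p))
  map_add' p q := by
    refine WithLp.ofLp_injective 2 (Prod.ext ?_ ?_) <;> ext i <;> simp [phaseRot] <;> ring
  map_smul' c p := by
    refine WithLp.ofLp_injective 2 (Prod.ext ?_ ?_) <;> ext i <;> simp [phaseRot] <;> ring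
  left_inv p := by
    have := phaseRot_comp (-θ) (WithLp.ofLp p)
    rw [neg_neg] at this
    simp [this]
  right_inv p := by
    simp [phaseRot_comp]
  norm_map' p := by
    have h := phaseRot_norm θ (WithLp.ofLp p)
    rw [← sq_eq_sq₀ (norm_nonneg _) (norm_nonneg _)]
    rw [WithLp.prod_norm_sq_eq_of_L2, WithLp.prod_norm_sq_eq_of_L2]
    exact h

theorem measurePreserving_phaseRot (θ : ℝ) : MeasurePreserving (phaseRot θ) :=
  (WithLp.volume_preserving_ofLp E2 E2).comp
    ((phaseRotIso θ).measurePreserving.comp (WithLp.volume_preserving_toLp E2 E2))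

theorem lintegral_comp_phaseRot (θ : ℝ) (F : E2 × E2 → ℝ≥0∞) (hF : Measurable F) :
    ∫⁻ p, F (phaseRot θ p) = ∫⁻ p, F p :=
  (measurePreserving_phaseRot θ).lintegral_comp hF

/-- If the Bargmann transforms of two Schwartz functions agree up to a phase and a rotation, then
the functions have the same mass. -/
theorem mass_eq_of_bargmann (f g : 𝓢(E2, ℂ)) (θ φ : ℝ) (h : ∀ z : Fin 2 → ℂ,
    ∫ x, f x * cohState z x
      = Complex.exp (φ * I) * ∫ x, g x * cohState (fun i => Complex.exp (θ * I) * z i) x) :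
    ∫⁻ x, ‖f x‖ₑ ^ 2 = ∫⁻ x, ‖g x‖ₑ ^ 2 := by
  have h1 : ∀ p, bargDensity f p = bargDensity g (phaseRot θ p) := by
    intro p
    unfold bargDensity
    rw [phaseRot_norm, h, enorm_mul, cvec_phaseRot]
    congr 2
    rw [← ofReal_norm, Complex.norm_exp_ofReal_mul_I]
    simp
  have h2 : ∫⁻ p, bargDensity f p = ∫⁻ p, bargDensity g p := by
    simp_rw [h1]
    exact lintegral_comp_phaseRot θ _ (measurable_bargDensity g)
  rw [lintegral_bargDensity, lintegral_bargDensity] at h2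
  exact (ENNReal.mul_right_inj bargConst_ne_zero bargConst_ne_top).1 h2

/-- Joint smoothness of a time-dependent function. -/
def JSmooth (w : ℝ → E2 → ℂ) : Prop := ContDiff ℝ ∞ (fun p : ℝ × E2 => w p.1 p.2)

theorem contDiff_pd {f : E2 → ℂ} (hf : ContDiff ℝ ∞ f) (i : Fin 2) : ContDiff ℝ ∞ (pd i f) := by
  unfold pd
  exact (hf.fderiv_right (m := ∞) le_rfl).clm_apply contDiff_const

theorem pd_add {f g : E2 → ℂ} (hf : Differentiable ℝ f) (hg : Differentiable ℝ g) (i : Fin 2)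
    (x : E2) : pd i (fun y => f y + g y) x = pd i f x + pd i g x := by
  unfold pd
  rw [fderiv_fun_add (hf x) (hg x)]; rfl

theorem pd_mul {f g : E2 → ℂ} (hf : Differentiable ℝ f) (hg : Differentiable ℝ g) (i : Fin 2)
    (x : E2) : pd i (fun y => f y * g y) x = pd i f x * g x + f x * pd i g x := by
  unfold pd
  rw [fderiv_fun_mul (hf x) (hg x)]
  simp; ring

theorem pd_const_mul (c : ℂ) {f : E2 → ℂ} (hf : Differentiable ℝ f) (i : Fin 2) (x : E2) :
    pd i (fun y => c * f y) x = c * pd i f x := by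
  unfold pd
  rw [fderiv_const_mul (hf x)]
  simp

theorem pd_coord (i j : Fin 2) (x : E2) :
    pd i (fun y => ((y j : ℝ) : ℂ)) x = if j = i then 1 else 0 := by
  have h : HasFDerivAt (fun y : E2 => ((y j : ℝ) : ℂ))
      (Complex.ofRealCLM.comp (EuclideanSpace.proj j : E2 →L[ℝ] ℝ)) x :=
    (Complex.ofRealCLM.comp (EuclideanSpace.proj j : E2 →L[ℝ] ℝ)).hasFDerivAt
  unfold pd
  rw [h.fderiv]
  by_cases hij : j = i
  · subst hij; simp
  · simp [hij]

theorem contDiff_coord (j : Fin 2) : ContDiff ℝ ∞ (fun y : E2 => ((y j : ℝ) : ℂ)) :=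
  (Complex.ofRealCLM.comp (EuclideanSpace.proj j : E2 →L[ℝ] ℝ)).contDiff

theorem JSmooth.slice {w : ℝ → E2 → ℂ} (hw : JSmooth w) (t : ℝ) : ContDiff ℝ ∞ (w t) :=
  hw.comp (contDiff_prodMk_right t)

theorem JSmooth.diff_slice {w : ℝ → E2 → ℂ} (hw : JSmooth w) (t : ℝ) : Differentiable ℝ (w t) :=
  (hw.slice t).differentiable (by simp)

theorem JSmooth.pd_eq {w : ℝ → E2 → ℂ} (hw : JSmooth w) (i : Fin 2) (t : ℝ) (x : E2) :
    pd i (w t) x = fderiv ℝ (fun p : ℝ × E2 => w p.1 p.2) (t, x) (0, EuclideanSpace.single i 1) := by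
  have h1 : HasFDerivAt (fun p : ℝ × E2 => w p.1 p.2) _ (t, x) :=
    ((hw.differentiable (by simp)) (t, x)).hasFDerivAt
  have h2 := h1.comp x (hasFDerivAt_prodMk_right t x)
  unfold pd
  have h3 : fderiv ℝ (w t) x = _ := h2.fderiv
  rw [h3]; simp

theorem JSmooth.pd {w : ℝ → E2 → ℂ} (hw : JSmooth w) (i : Fin 2) :
    JSmooth (fun t x => pd i (w t) x) := by
  unfold JSmooth
  simp_rw [hw.pd_eq i]
  exact (ContDiff.fderiv_right (m := ∞) hw le_rfl).clm_apply contDiff_const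

theorem JSmooth.deriv_eq {w : ℝ → E2 → ℂ} (hw : JSmooth w) (t : ℝ) (x : E2) :
    HasDerivAt (fun s => w s x) (fderiv ℝ (fun p : ℝ × E2 => w p.1 p.2) (t, x) (1, 0)) t := by
  have h1 : HasFDerivAt (fun p : ℝ × E2 => w p.1 p.2) _ (t, x) :=
    ((hw.differentiable (by simp)) (t, x)).hasFDerivAt
  have h2 : HasDerivAt (fun s : ℝ => (s, x)) ((1 : ℝ), (0 : E2)) t :=
    (hasDerivAt_id t).prodMk (hasDerivAt_const t x)
  exact h1.comp_hasDerivAt t h2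

theorem JSmooth.hasDerivAt {w : ℝ → E2 → ℂ} (hw : JSmooth w) (t : ℝ) (x : E2) :
    HasDerivAt (fun s => w s x) (deriv (fun s => w s x) t) t :=
  (hw.deriv_eq t x).differentiableAt.hasDerivAt

theorem JSmooth.tderiv {w : ℝ → E2 → ℂ} (hw : JSmooth w) :
    JSmooth (fun t x => deriv (fun s => w s x) t) := by
  unfold JSmooth
  simp_rw [fun t x => (hw.deriv_eq t x).deriv]
  exact (ContDiff.fderiv_right (m := ∞) hw le_rfl).clm_apply contDiff_const

/-- Time and space derivatives commute. -/
theorem JSmooth.deriv_pd {w : ℝ → E2 → ℂ} (hw : JSmooth w) (i : Fin 2) (t : ℝ) (x : E2) :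
    deriv (fun s => _root_.pd i (w s) x) t
      = _root_.pd i (fun y => deriv (fun s => w s y) t) x := by
  set W := fun p : ℝ × E2 => w p.1 p.2 with hW
  have hW2 : ContDiff ℝ ∞ (fderiv ℝ W) := ContDiff.fderiv_right (m := ∞) hw le_rfl
  have hd := (hW2.differentiable (by simp)) (t, x)
  rw [(hw.pd i |>.deriv_eq t x).deriv]
  rw [hw.tderiv.pd_eq i t x]
  simp_rw [hw.pd_eq i, fun t x => (hw.deriv_eq t x).deriv]
  rw [fderiv_clm_apply hd (differentiableAt_const _), fderiv_clm_apply hd (differentiableAt_const _)]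
  have hsymm : IsSymmSndFDerivAt ℝ W (t, x) :=
    (ContDiff.contDiffAt hw).isSymmSndFDerivAt
      (by rw [minSmoothness_of_isRCLikeNormedField]; exact WithTop.coe_le_coe.2 (le_top : (2 : ℕ∞) ≤ ⊤))
  have := hsymm.eq (1, 0) (0, EuclideanSpace.single i 1)
  simpa using this

theorem pd_comm {f : E2 → ℂ} (hf : ContDiff ℝ ∞ f) (i j : Fin 2) (x : E2) :
    pd i (pd j f) x = pd j (pd i f) x := by
  have hW2 : ContDiff ℝ ∞ (fderiv ℝ f) := hf.fderiv_right (m := ∞) le_rfl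
  have hd := (hW2.differentiable (by simp)) x
  unfold pd
  rw [fderiv_clm_apply hd (differentiableAt_const _), fderiv_clm_apply hd (differentiableAt_const _)]
  have hsymm : IsSymmSndFDerivAt ℝ f x := hf.contDiffAt.isSymmSndFDerivAt
      (by rw [minSmoothness_of_isRCLikeNormedField]; exact WithTop.coe_le_coe.2 (le_top : (2 : ℕ∞) ≤ ⊤))
  have := hsymm.eq (EuclideanSpace.single i 1) (EuclideanSpace.single j 1)
  simpa using this

theorem hasCompactSupport_pd {g : E2 → ℂ} (hg : HasCompactSupport g) (i : Fin 2) :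
    HasCompactSupport (pd i g) :=
  hg.fderiv_apply (𝕜 := ℝ) _

theorem integral_pd_mul {f g : E2 → ℂ} (hf : ContDiff ℝ ∞ f) (hg : ContDiff ℝ ∞ g)
    (hgc : HasCompactSupport g) (i : Fin 2) :
    ∫ x, pd i f x * g x = - ∫ x, f x * pd i g x := by
  have := integral_mul_fderiv_eq_neg_fderiv_mul_of_integrable (μ := volume) (f := f) (g := g)
    (v := EuclideanSpace.single i (1 : ℝ))
    (((contDiff_pd hf i).continuous.mul hg.continuous).integrable_of_hasCompactSupport hgc.mul_left)
    ((hf.continuous.mul (contDiff_pd hg i).continuous).integrable_of_hasCompactSupport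
      (hasCompactSupport_pd hgc i).mul_left)
    ((hf.continuous.mul hg.continuous).integrable_of_hasCompactSupport hgc.mul_left)
    (fun x _ => (hf.differentiable (by simp)) x) (fun x _ => (hg.differentiable (by simp)) x)
  change ∫ x, f x * pd i g x = - ∫ x, pd i f x * g x at this
  rw [this, neg_neg]

theorem integral_pd_pd_mul {f g : E2 → ℂ} (hf : ContDiff ℝ ∞ f) (hg : ContDiff ℝ ∞ g)
    (hgc : HasCompactSupport g) (i : Fin 2) :
    ∫ x, pd i (pd i f) x * g x = ∫ x, f x * pd i (pd i g) x := by
  rw [integral_pd_mul (contDiff_pd hf i) hg hgc, integral_pd_mul hf (contDiff_pd hg i)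
    (hasCompactSupport_pd hgc i), neg_neg]

/-- Green's identity against a compactly supported test function. -/
theorem integral_lap_mul {f g : E2 → ℂ} (hf : ContDiff ℝ ∞ f) (hg : ContDiff ℝ ∞ g)
    (hgc : HasCompactSupport g) :
    ∫ x, lap f x * g x = ∫ x, f x * lap g x := by
  unfold lap
  simp_rw [Finset.sum_mul, Finset.mul_sum]
  rw [integral_finsetSum, integral_finsetSum]
  · exact Finset.sum_congr rfl fun i _ => integral_pd_pd_mul hf hg hgc i
  · intro i _
    exact (hf.continuous.mul (contDiff_pd (contDiff_pd hg i) i).continuous).integrable_of_hasCompactSupport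
      (hasCompactSupport_pd (hasCompactSupport_pd hgc i) i).mul_left
  · intro i _
    exact ((contDiff_pd (contDiff_pd hf i) i).continuous.mul hg.continuous).integrable_of_hasCompactSupport
      hgc.mul_left

theorem lap_mul {f g : E2 → ℂ} (hf : ContDiff ℝ ∞ f) (hg : ContDiff ℝ ∞ g) (x : E2) :
    lap (fun y => f y * g y) x
      = lap f x * g x + (∑ i, 2 * (pd i f x * pd i g x)) + f x * lap g x := by
  have hfd := hf.differentiable (by simp)
  have hgd := hg.differentiable (by simp)
  have key : ∀ i, pd i (pd i (fun y => f y * g y)) x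
      = pd i (pd i f) x * g x + 2 * (pd i f x * pd i g x) + f x * pd i (pd i g) x := by
    intro i
    have e : pd i (fun y => f y * g y) = fun y => pd i f y * g y + f y * pd i g y := by
      funext y; exact pd_mul hfd hgd i y
    have hf1 := (contDiff_pd hf i).differentiable (by simp)
    have hg1 := (contDiff_pd hg i).differentiable (by simp)
    rw [e, pd_add (f := fun y => pd i f y * g y) (g := fun y => f y * pd i g y)
      (hf1.mul hgd) (hfd.mul hg1), pd_mul hf1 hgd, pd_mul hfd hg1]
    ring
  unfold lap
  simp_rw [key, Finset.sum_add_distrib, Finset.sum_mul, Finset.mul_sum]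

/-- Fundamental theorem of calculus under a spatial integral. -/
theorem intervalIntegral_integral_eq_sub {X : Type*} [MeasurableSpace X] {μ : Measure X}
    [SFinite μ] {G G' : ℝ → X → ℂ} {s t : ℝ}
    (hG : ∀ x τ, HasDerivAt (fun r => G r x) (G' τ x) τ)
    (hc : ∀ x, Continuous fun τ => G' τ x)
    (hinteg : Integrable (Function.uncurry G') ((volume.restrict (Set.uIoc s t)).prod μ))
    (hs : Integrable (G s) μ) (ht : Integrable (G t) μ) :
    ∫ τ in s..t, ∫ x, G' τ x ∂μ = ∫ x, G t x ∂μ - ∫ x, G s x ∂μ := by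
  rw [intervalIntegral_integral_swap hinteg, ← integral_sub ht hs]
  congr 1; funext x
  exact intervalIntegral.integral_eq_sub_of_hasDerivAt (fun τ _ => hG x τ)
    ((hc x).intervalIntegrable _ _)

theorem contDiff_cohState (z : Fin 2 → ℂ) : ContDiff ℝ ∞ (cohState z) := by
  unfold cohState
  refine ContDiff.cexp (ContDiff.sub (ContDiff.add ?_ ?_) contDiff_const)
  · exact (Complex.ofRealCLM.contDiff.comp (contDiff_norm_sq ℝ)).neg.div_const _
  · exact ContDiff.sum fun i _ => contDiff_const.mul (contDiff_coord i)

theorem pd_cohState (z : Fin 2 → ℂ) (i : Fin 2) (x : E2) :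
    pd i (cohState z) x = (z i - x i) * cohState z x := by
  have hd : DifferentiableAt ℝ (cohState z) x :=
    ((contDiff_cohState z).differentiable (by simp)) x
  have h1 : HasDerivAt (fun s : ℝ => cohState z (x + s • EuclideanSpace.single i (1 : ℝ)))
      (pd i (cohState z) x) 0 :=
    hd.hasFDerivAt.hasLineDerivAt (EuclideanSpace.single i (1 : ℝ))
  have h2 : HasDerivAt (fun s : ℝ => cohState z (x + s • EuclideanSpace.single i (1 : ℝ)))
      ((z i - x i) * cohState z x) 0 := by
    have e : (fun s : ℝ => cohState z (x + s • EuclideanSpace.single i (1 : ℝ)))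
        = fun s : ℝ => cohState z x * Complex.exp ((s : ℂ) * (z i - x i) - (s : ℂ) ^ 2 / 2) := by
      funext s
      unfold cohState
      rw [← Complex.exp_add]
      congr 1
      rw [norm_sq_E2, norm_sq_E2]
      fin_cases i <;> simp [Fin.sum_univ_two] <;> ring
    rw [e]
    have h3 : HasDerivAt (fun s : ℂ => cohState z x
        * Complex.exp (s * (z i - x i) - s ^ 2 / 2))
        (cohState z x * (Complex.exp ((0:ℂ) * (z i - x i) - (0:ℂ) ^ 2 / 2) *
          (1 * (z i - x i) - (2 * (0:ℂ)) / 2))) ((0 : ℝ) : ℂ) := by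
      have := (((hasDerivAt_id (0:ℂ)).mul_const (z i - (x i : ℂ))).sub
        (((hasDerivAt_id (0:ℂ)).pow 2).div_const 2)).cexp.const_mul (cohState z x)
      simpa using this
    have := h3.comp_ofReal
    convert! this using 1
    simp; ring
  exact h1.unique h2

theorem lap_cohState (z : Fin 2 → ℂ) (x : E2) :
    lap (cohState z) x = ((∑ i, (z i - x i) ^ 2) - 2) * cohState z x := by
  have e : ∀ i, pd i (cohState z) = fun y => (z i - (y i : ℂ)) * cohState z y := fun i =>
    funext fun y => pd_cohState z i y
  have h2 : ∀ i, pd i (pd i (cohState z)) x = ((z i - x i) ^ 2 - 1) * cohState z x := by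
    intro i
    have hc := (contDiff_coord i).differentiable (by simp)
    have e2 : (fun y : E2 => z i - (y i : ℂ)) = fun y => z i + (-1) * (y i : ℂ) := by
      funext y; ring
    rw [e, pd_mul (f := fun y => z i - (y i : ℂ)) (by fun_prop)
      ((contDiff_cohState z).differentiable (by simp)), pd_cohState, e2,
      pd_add (f := fun _ => z i) (g := fun y => (-1) * (y i : ℂ)) (by fun_prop) (by fun_prop),
      pd_const_mul _ hc, pd_coord]
    simp [pd]; ring
  unfold lap
  simp_rw [h2]
  simp [Fin.sum_univ_two]; ring

/-- The solution `exp (-2it) cohState (exp (-2it) z)` of the conjugate linear equation. -/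
def cohSol (z : Fin 2 → ℂ) (t : ℝ) (x : E2) : ℂ :=
  Complex.exp (-2 * t * I) * cohState (fun i => Complex.exp (-2 * t * I) * z i) x

theorem jsmooth_cohSol (z : Fin 2 → ℂ) : JSmooth (cohSol z) := by
  unfold JSmooth cohSol cohState
  have h1 : ContDiff ℝ ∞ (fun p : ℝ × E2 => Complex.exp (-2 * (p.1 : ℂ) * I)) := by
    refine ContDiff.cexp (ContDiff.mul (ContDiff.mul contDiff_const ?_) contDiff_const)
    exact Complex.ofRealCLM.contDiff.comp contDiff_fst
  refine h1.mul ?_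
  have h2 (i : Fin 2) : ContDiff ℝ ∞
      (fun p : ℝ × E2 => Complex.exp (-2 * (p.1 : ℂ) * I) * z i) := h1.mul contDiff_const
  have h3 : ContDiff ℝ ∞ (fun p : ℝ × E2 => ((‖p.2‖ ^ 2 : ℝ) : ℂ)) :=
    Complex.ofRealCLM.contDiff.comp ((contDiff_norm_sq ℝ).comp contDiff_snd)
  have h4 (i : Fin 2) : ContDiff ℝ ∞ (fun p : ℝ × E2 => ((p.2 i : ℝ) : ℂ)) :=
    (contDiff_coord i).comp contDiff_snd
  refine ContDiff.cexp (ContDiff.sub (ContDiff.add ?_ ?_) ?_)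
  · exact h3.neg.div_const _
  · exact ContDiff.sum fun i _ => (h2 i).mul (h4 i)
  · exact (ContDiff.sum fun i _ => (h2 i).pow 2).div_const _

theorem hasDerivAt_cohSol (z : Fin 2 → ℂ) (t : ℝ) (x : E2) :
    HasDerivAt (fun s => cohSol z s x)
      (I * (lap (cohSol z t) x - (‖x‖ : ℂ) ^ 2 * cohSol z t x)) t := by
  have hl : lap (cohSol z t) x = Complex.exp (-2 * t * I)
      * lap (cohState (fun i => Complex.exp (-2 * t * I) * z i)) x := by
    have hs := contDiff_cohState (fun i => Complex.exp (-2 * t * I) * z i)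
    have e : ∀ i, pd i (cohSol z t) = fun y => Complex.exp (-2 * t * I)
        * pd i (cohState (fun i => Complex.exp (-2 * t * I) * z i)) y := fun i =>
      funext fun y => pd_const_mul _ (hs.differentiable (by simp)) i y
    unfold lap
    simp_rw [e, pd_const_mul _ ((contDiff_pd hs _).differentiable (by simp)), Finset.mul_sum]
  rw [hl, lap_cohState]
  have hE : HasDerivAt (fun s : ℂ => Complex.exp (-2 * s * I))
      (Complex.exp (-2 * (t : ℂ) * I) * (-2 * I)) (t : ℂ) := by
    have := (((hasDerivAt_id (t : ℂ)).const_mul (-2)).mul_const I).cexp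
    simpa using this
  have h1 : HasDerivAt (fun s : ℂ => Complex.exp (-2 * s * I) *
      cohState (fun i => Complex.exp (-2 * s * I) * z i) x) 
      (I * (Complex.exp (-2 * t * I) * (((∑ i, (Complex.exp (-2 * t * I) * z i - x i) ^ 2) - 2)
        * cohState (fun i => Complex.exp (-2 * t * I) * z i) x)
        - (‖x‖ : ℂ) ^ 2 * cohSol z t x)) (t : ℂ) := by
    unfold cohSol cohState
    simp only [Fin.sum_univ_two]
    have h2 := (((hE.mul_const (z 0)).mul_const (x 0 : ℂ)).add
      ((hE.mul_const (z 1)).mul_const (x 1 : ℂ))).const_add (-((‖x‖ ^ 2 : ℝ) : ℂ) / 2)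
    have h3 := ((((hE.mul_const (z 0)).pow 2).add ((hE.mul_const (z 1)).pow 2))).div_const (4 : ℂ)
    have h4 := hE.mul (h2.sub h3).cexp
    refine h4.congr_deriv ?_
    have hn : (‖x‖ : ℂ) ^ 2 = (x 0 : ℂ) ^ 2 + (x 1 : ℂ) ^ 2 := by
      rw [← Complex.ofReal_pow, norm_sq_E2]; push_cast; ring
    simp only [Pi.add_apply, Pi.sub_apply, Pi.pow_apply]
    rw [hn]
    push_cast
    ring
  exact h1.comp_ofReal

/-- Smooth pointwise solutions of the linear equation, as plain functions. -/
structure LinSol (w : ℝ → E2 → ℂ) : Prop where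
  smooth : JSmooth w
  eq : ∀ t x, deriv (fun s => w s x) t = I * (-lap (w t) x + (‖x‖ : ℂ) ^ 2 * w t x)

theorem integrable_prod_of_compact {F : ℝ × E2 → ℂ} (hF : Continuous F) {K : Set E2}
    (hK : IsCompact K) (h0 : ∀ p : ℝ × E2, p.2 ∉ K → F p = 0) (s t : ℝ) :
    Integrable F ((volume.restrict (Set.uIoc s t)).prod volume) := by
  have h1 : (volume.restrict (Set.uIoc s t)).prod (volume : Measure E2)
      = (volume : Measure (ℝ × E2)).restrict (Set.uIoc s t ×ˢ Set.univ) := by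
    rw [Measure.volume_eq_prod, ← Measure.prod_restrict, Measure.restrict_univ]
  rw [h1]
  have h2 : IntegrableOn F (Set.uIcc s t ×ˢ K) volume :=
    hF.continuousOn.integrableOn_compact (isCompact_uIcc.prod hK)
  have h3 : IntegrableOn F (Set.uIoc s t ×ˢ K) volume :=
    h2.mono_set (Set.prod_mono Set.uIoc_subset_uIcc le_rfl)
  refine h3.of_forall_sdiff_eq_zero (measurableSet_uIoc.prod MeasurableSet.univ) ?_
  rintro ⟨a, b⟩ ⟨hp, hq⟩
  apply h0
  intro hb
  exact hq ⟨hp.1, hb⟩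

theorem JSmooth.continuous {w : ℝ → E2 → ℂ} (hw : JSmooth w) :
    Continuous fun p : ℝ × E2 => w p.1 p.2 := ContDiff.continuous hw

theorem JSmooth.lap {w : ℝ → E2 → ℂ} (hw : JSmooth w) : JSmooth fun t x => lap (w t) x := by
  unfold JSmooth _root_.lap
  exact ContDiff.sum fun i _ => (hw.pd i).pd i

theorem contDiff_lap {f : E2 → ℂ} (hf : ContDiff ℝ ∞ f) : ContDiff ℝ ∞ (lap f) :=
  ContDiff.sum fun i _ => contDiff_pd (contDiff_pd hf i) i

theorem hasCompactSupport_lap {f : E2 → ℂ} (hf : HasCompactSupport f) :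
    HasCompactSupport (lap f) := by
  have e : lap f = fun x => pd 0 (pd 0 f) x + pd 1 (pd 1 f) x := by
    funext x; simp [lap, Fin.sum_univ_two]
  rw [e]
  exact (hasCompactSupport_pd (hasCompactSupport_pd hf 0) 0).add
    (hasCompactSupport_pd (hasCompactSupport_pd hf 1) 1)

theorem continuous_time_slice {X Y : Type*} [TopologicalSpace X] [TopologicalSpace Y]
    {G : ℝ → X → Y} (hG : Continuous fun p : ℝ × X => G p.1 p.2) (x : X) :
    Continuous fun τ => G τ x :=
  hG.comp (Continuous.prodMk continuous_id continuous_const)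

theorem LinSol.weak {w : ℝ → E2 → ℂ} (hw : LinSol w) {χ : E2 → ℂ} (hχ : ContDiff ℝ ∞ χ)
    (hχc : HasCompactSupport χ) (z : Fin 2 → ℂ) (s t : ℝ) :
    (∫ x, w t x * (χ x * cohSol z t x)) - ∫ x, w s x * (χ x * cohSol z s x)
      = ∫ τ in s..t, -I * ∫ x, w τ x * (lap χ x * cohSol z τ x
          + ∑ i, 2 * (pd i χ x * pd i (cohSol z τ) x)) := by
  have hκ := jsmooth_cohSol z
  have hχj : Continuous fun p : ℝ × E2 => χ p.2 := hχ.continuous.comp continuous_snd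
  set G' : ℝ → E2 → ℂ := fun τ x => I * (-(lap (w τ) x * (χ x * cohSol z τ x))
    + w τ x * (χ x * lap (cohSol z τ) x)) with hG'
  have hGc : Continuous (fun p : ℝ × E2 => G' p.1 p.2) := by
    have := hw.smooth.lap.continuous
    have := hw.smooth.continuous
    have := hκ.continuous
    have := hκ.lap.continuous
    fun_prop
  clear_value G'
  have hinteg (τ : ℝ) {f : E2 → ℂ} (hf : Continuous f) :
      Integrable fun x => w τ x * (χ x * f x) :=
    (((hw.smooth.slice τ).continuous).mul (hχ.continuous.mul hf)).integrable_of_hasCompactSupport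
      hχc.mul_right.mul_left
  rw [← intervalIntegral_integral_eq_sub (μ := volume)
    (G := fun τ x => w τ x * (χ x * cohSol z τ x)) (G' := G') ?_ ?_ ?_ (hinteg s (hκ.slice s).continuous)
    (hinteg t (hκ.slice t).continuous)]
  · congr 1; funext τ
    have hg : ContDiff ℝ ∞ fun x => χ x * cohSol z τ x := hχ.mul (hκ.slice τ)
    have hgc : HasCompactSupport fun x => χ x * cohSol z τ x := hχc.mul_right
    rw [hG', integral_const_mul, integral_add, integral_neg, integral_lap_mul (hw.smooth.slice τ) hg hgc]
    · rw [neg_mul, ← mul_neg, ← integral_neg, ← integral_neg, ← integral_add]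
      · congr 2; funext x
        rw [lap_mul hχ (hκ.slice τ)]
        ring
      · exact (((hw.smooth.slice τ).continuous.mul
          (contDiff_lap hg |>.continuous)).integrable_of_hasCompactSupport
          (hasCompactSupport_lap hgc).mul_left).neg
      · exact hinteg τ (hκ.lap.slice τ).continuous
    · exact ((((hw.smooth.lap.slice τ).continuous).mul hg.continuous).integrable_of_hasCompactSupport
        hgc.mul_left).neg
    · exact hinteg τ (hκ.lap.slice τ).continuous
  · intro x τ
    have h1 := hw.smooth.hasDerivAt τ x
    rw [hw.eq] at h1
    refine (h1.mul ((hasDerivAt_cohSol z τ x).const_mul (χ x))).congr_deriv ?_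
    rw [hG']; ring
  · intro x
    exact continuous_time_slice hGc x
  · refine integrable_prod_of_compact (K := tsupport χ) hGc hχc ?_ s t
    intro p hp
    simp [hG', image_eq_zero_of_notMem_tsupport hp]

theorem norm_exp_phase (c t : ℝ) : ‖Complex.exp (c * t * I)‖ = 1 := by
  rw [← Complex.ofReal_mul]; exact Complex.norm_exp_ofReal_mul_I _

theorem abs_coord_le (x : E2) (i : Fin 2) : |x i| ≤ ‖x‖ := PiLp.norm_apply_le x i

theorem norm_cohState_le (z : Fin 2 → ℂ) {Z : ℝ} (hZ : ‖z 0‖ + ‖z 1‖ ≤ Z) (x : E2) :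
    ‖cohState z x‖ ≤ Real.exp (-‖x‖ ^ 2 / 2 + Z * ‖x‖ + Z ^ 2) := by
  unfold cohState
  rw [Complex.norm_exp, Real.exp_le_exp]
  have h0 : 0 ≤ Z := le_trans (by positivity) hZ
  have e1 : (-((‖x‖ ^ 2 : ℝ) : ℂ) / 2).re = -‖x‖ ^ 2 / 2 := by
    have : (-((‖x‖ ^ 2 : ℝ) : ℂ) / 2) = ((-‖x‖ ^ 2 / 2 : ℝ) : ℂ) := by push_cast; ring
    rw [this, Complex.ofReal_re]
  have e2 : (∑ i, z i * x i : ℂ).re ≤ Z * ‖x‖ := by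
    refine (Complex.re_le_norm _).trans ?_
    rw [Fin.sum_univ_two]
    refine (norm_add_le _ _).trans ?_
    simp only [norm_mul, Complex.norm_real, Real.norm_eq_abs]
    have := mul_le_mul_of_nonneg_left (abs_coord_le x 0) (norm_nonneg (z 0))
    have := mul_le_mul_of_nonneg_left (abs_coord_le x 1) (norm_nonneg (z 1))
    have := mul_le_mul_of_nonneg_right hZ (norm_nonneg x)
    linarith
  have e3 : -((∑ i, (z i) ^ 2) / 4 : ℂ).re ≤ Z ^ 2 := by
    rw [← Complex.neg_re]
    refine (Complex.re_le_norm _).trans ?_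
    rw [norm_neg, norm_div, Fin.sum_univ_two]
    have h1 := norm_add_le (z 0 ^ 2) (z 1 ^ 2)
    rw [norm_pow, norm_pow] at h1
    have h4 : ‖(4 : ℂ)‖ = 4 := by simp
    rw [h4]
    have := norm_nonneg (z 0)
    have := norm_nonneg (z 1)
    nlinarith [mul_self_le_mul_self (by positivity) hZ]
  rw [Complex.sub_re, Complex.add_re, e1]
  linarith

theorem pd_cohSol (z : Fin 2 → ℂ) (t : ℝ) (i : Fin 2) (x : E2) :
    pd i (cohSol z t) x = (Complex.exp (-2 * t * I) * z i - x i) * cohSol z t x := by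
  unfold cohSol
  rw [pd_const_mul _ ((contDiff_cohState _).differentiable (by simp)), pd_cohState]
  ring

theorem exists_bound_cohSol (z : Fin 2 → ℂ) : ∃ C : ℝ, 0 ≤ C ∧ ∀ t x,
    ‖cohSol z t x‖ ≤ C * Real.exp (-‖x‖ ^ 2 / 4) ∧
    ∀ i, ‖pd i (cohSol z t) x‖ ≤ C * Real.exp (-‖x‖ ^ 2 / 4) := by
  set Z := ‖z 0‖ + ‖z 1‖ with hZ
  have hZ0 : 0 ≤ Z := by positivity
  refine ⟨Real.exp ((Z + 1) ^ 2 + Z ^ 2 + Z), (Real.exp_pos _).le, fun t x => ?_⟩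
  have hph : ‖Complex.exp (-2 * t * I)‖ = 1 := by
    have := norm_exp_phase (-2) t
    push_cast at this; exact this
  have h1 : ‖cohSol z t x‖ ≤ Real.exp (-‖x‖ ^ 2 / 2 + Z * ‖x‖ + Z ^ 2) := by
    unfold cohSol
    rw [norm_mul, hph, one_mul]
    apply norm_cohState_le
    simp only [norm_mul, hph, one_mul]
    exact le_rfl
  have hx := norm_nonneg x
  have h2 : (1 + Z + ‖x‖) * Real.exp (-‖x‖ ^ 2 / 2 + Z * ‖x‖ + Z ^ 2)
      ≤ Real.exp ((Z + 1) ^ 2 + Z ^ 2 + Z) * Real.exp (-‖x‖ ^ 2 / 4) := by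
    have h3 : 1 + Z + ‖x‖ ≤ Real.exp (Z + ‖x‖) := by
      have := Real.add_one_le_exp (Z + ‖x‖); linarith
    refine (mul_le_mul_of_nonneg_right h3 (Real.exp_pos _).le).trans ?_
    rw [← Real.exp_add, ← Real.exp_add, Real.exp_le_exp]
    nlinarith [sq_nonneg (‖x‖ / 2 - (Z + 1))]
  refine ⟨h1.trans (le_trans ?_ h2), fun i => ?_⟩
  · exact le_mul_of_one_le_left (Real.exp_pos _).le (by linarith)
  · rw [pd_cohSol, norm_mul]
    refine le_trans (mul_le_mul ?_ h1 (norm_nonneg _) (by positivity)) h2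
    refine (norm_sub_le _ _).trans ?_
    rw [norm_mul, hph, one_mul, Complex.norm_real, Real.norm_eq_abs]
    have h5 : ‖z i‖ ≤ Z := by
      fin_cases i <;> simp [hZ]
    linarith [abs_coord_le x i]

theorem integrable_gaussian_half : Integrable fun x : E2 => Real.exp (-‖x‖ ^ 2 / 2) := by
  have h := GaussianFourier.integrable_cexp_neg_mul_sq_norm_add (V := E2) (b := 1 / 2)
    (by norm_num) 0 0
  refine h.norm.congr (ae_of_all _ fun x => ?_)
  simp only [Complex.norm_exp]
  congr 1
  have : (-(1 / 2 : ℂ) * (‖x‖ : ℂ) ^ 2 + 0 * ((inner ℝ (0 : E2) x : ℝ) : ℂ))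
      = ((-‖x‖ ^ 2 / 2 : ℝ) : ℂ) := by push_cast; ring
  rw [this, Complex.ofReal_re]

theorem mul_gaussian_le (a : ℝ) (x : E2) :
    a * Real.exp (-‖x‖ ^ 2 / 4) ≤ a ^ 2 + Real.exp (-‖x‖ ^ 2 / 2) := by
  have h : Real.exp (-‖x‖ ^ 2 / 2) = Real.exp (-‖x‖ ^ 2 / 4) ^ 2 := by
    rw [← Real.exp_nat_mul]; congr 1; push_cast; ring
  rw [h]
  nlinarith [sq_nonneg (a - Real.exp (-‖x‖ ^ 2 / 4)), sq_nonneg a,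
    sq_nonneg (Real.exp (-‖x‖ ^ 2 / 4))]

theorem pd_comp_smul (i : Fin 2) (f : E2 → ℂ) (c : ℝ) (x : E2) :
    pd i (fun y => f (c • y)) x = c * pd i f (c • x) := by
  unfold pd
  rw [fderiv_comp_smul]
  simp

theorem lap_comp_smul {f : E2 → ℂ} (hf : ContDiff ℝ ∞ f) (c : ℝ) (x : E2) :
    lap (fun y => f (c • y)) x = c * (c * lap f (c • x)) := by
  unfold lap
  have e : ∀ i, pd i (fun y => f (c • y)) = fun y => (c : ℂ) * (fun u => pd i f u) (c • y) :=
    fun i => funext fun y => pd_comp_smul i f c y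
  have hd : ∀ i, Differentiable ℝ fun y : E2 => pd i f (c • y) := fun i =>
    ((contDiff_pd hf i).differentiable (by simp)).comp (differentiable_id.const_smul c)
  simp_rw [e, fun i => pd_const_mul (c : ℂ) (hd i) i x, fun i => pd_comp_smul i (pd i f) c x,
    Finset.mul_sum]

/-- Pairings with coherent states are conserved along a solution that is bounded in `L²`. -/
theorem LinSol.pairing_eq {w : ℝ → E2 → ℂ} (hw : LinSol w)
    (hL : ∀ t, Integrable fun x => ‖w t x‖ ^ 2) {s t K : ℝ}
    (hK : ∀ τ ∈ Set.uIoc s t, ∫ x, ‖w τ x‖ ^ 2 ≤ K) (z : Fin 2 → ℂ) :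
    ∫ x, w t x * cohSol z t x = ∫ x, w s x * cohSol z s x := by
  obtain ⟨C, hC0, hC⟩ := exists_bound_cohSol z
  let ψ : ContDiffBump (0 : E2) := ⟨1, 2, by norm_num, by norm_num⟩
  set χ : E2 → ℂ := fun x => ((ψ x : ℝ) : ℂ) with hχ
  have hχs : ContDiff ℝ ∞ χ := Complex.ofRealCLM.contDiff.comp ψ.contDiff
  have hχc : HasCompactSupport χ := ψ.hasCompactSupport.comp_left Complex.ofReal_zero
  have hχ1 : ∀ x, ‖χ x‖ ≤ 1 := fun x => by
    rw [hχ, Complex.norm_real, Real.norm_eq_abs, abs_of_nonneg ψ.nonneg]; exact ψ.le_one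
  obtain ⟨D0, hD0⟩ := (hasCompactSupport_pd hχc 0).exists_bound_of_continuous
    (contDiff_pd hχs 0).continuous
  obtain ⟨D1, hD1⟩ := (hasCompactSupport_pd hχc 1).exists_bound_of_continuous
    (contDiff_pd hχs 1).continuous
  obtain ⟨D2, hD2⟩ := (hasCompactSupport_lap hχc).exists_bound_of_continuous
    (contDiff_lap hχs).continuous
  have hD00 : 0 ≤ D0 := (norm_nonneg _).trans (hD0 0)
  have hD10 : 0 ≤ D1 := (norm_nonneg _).trans (hD1 0)
  have hD20 : 0 ≤ D2 := (norm_nonneg _).trans (hD2 0)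
  let ε : ℕ → ℝ := fun n => 1 / ((n : ℝ) + 1)
  have hε : Tendsto ε atTop (𝓝 0) := tendsto_one_div_add_atTop_nhds_zero_nat
  have hε0 : ∀ n, 0 ≤ ε n := fun n => by positivity
  have hε1 : ∀ n, ε n ≤ 1 := fun n => by
    rw [div_le_one (by positivity)]; linarith [n.cast_nonneg (α := ℝ)]
  have hεpos : ∀ n, ε n ≠ 0 := fun n => by positivity
  have hlim : ∀ τ, Tendsto (fun n => ∫ x, w τ x * (χ (ε n • x) * cohSol z τ x)) atTop
      (𝓝 (∫ x, w τ x * cohSol z τ x)) := by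
    intro τ
    refine tendsto_integral_of_dominated_convergence
      (fun x => C * (‖w τ x‖ ^ 2 + Real.exp (-‖x‖ ^ 2 / 2))) ?_
      (((hL τ).add integrable_gaussian_half).const_mul C) ?_ ?_
    · intro n
      exact ((hw.smooth.slice τ).continuous.mul ((hχs.continuous.comp
        (continuous_const_smul (ε n))).mul
          ((jsmooth_cohSol z).slice τ).continuous)).aestronglyMeasurable
    · intro n
      refine ae_of_all _ fun x => ?_
      rw [norm_mul, norm_mul]
      calc ‖w τ x‖ * (‖χ (ε n • x)‖ * ‖cohSol z τ x‖)
          ≤ ‖w τ x‖ * (1 * (C * Real.exp (-‖x‖ ^ 2 / 4))) := by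
            gcongr
            · exact hχ1 _
            · exact (hC τ x).1
        _ = C * (‖w τ x‖ * Real.exp (-‖x‖ ^ 2 / 4)) := by ring
        _ ≤ _ := by gcongr; exact mul_gaussian_le _ _
    · refine ae_of_all _ fun x => ?_
      have h1 : Tendsto (fun n => χ (ε n • x)) atTop (𝓝 1) := by
        have h2 : χ ((0 : ℝ) • x) = 1 := by
          have : ψ (0 : E2) = 1 := ψ.one_of_mem_closedBall
            (Metric.mem_closedBall_self ψ.rIn_pos.le)
          rw [zero_smul]
          simp only [hχ, this, Complex.ofReal_one]
        rw [← h2]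
        exact (hχs.continuous.tendsto _).comp (hε.smul_const x)
      have h3 := (h1.mul_const (cohSol z τ x)).const_mul (w τ x)
      rwa [one_mul] at h3
  have hsmall : ∀ n, ‖(∫ x, w t x * (χ (ε n • x) * cohSol z t x))
      - ∫ x, w s x * (χ (ε n • x) * cohSol z s x)‖
      ≤ ε n * ((D2 + 2 * D0 + 2 * D1) * C * (K + ∫ x : E2, Real.exp (-‖x‖ ^ 2 / 2)))
        * |t - s| := by
    intro n
    have hcs : ContDiff ℝ ∞ fun x => χ (ε n • x) := hχs.comp (contDiff_const_smul (ε n))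
    have hcc : HasCompactSupport fun x => χ (ε n • x) :=
      hχc.comp_homeomorph (Homeomorph.smulOfNeZero (ε n) (hεpos n))
    rw [hw.weak hcs hcc z s t]
    refine intervalIntegral.norm_integral_le_of_norm_le_const fun τ hτ => ?_
    rw [norm_mul, norm_neg, norm_I, one_mul]
    have hi : Integrable fun x : E2 => ε n * ((D2 + 2 * D0 + 2 * D1) * C)
        * (‖w τ x‖ ^ 2 + Real.exp (-‖x‖ ^ 2 / 2)) :=
      ((hL τ).add integrable_gaussian_half).const_mul _
    refine (norm_integral_le_of_norm_le hi (ae_of_all _ fun x => ?_)).trans ?_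
    · have hP := mul_gaussian_le ‖w τ x‖ x
      set P := Real.exp (-‖x‖ ^ 2 / 4) with hPd
      have hP0 : 0 ≤ P := (Real.exp_pos _).le
      have hl : ‖lap (fun y => χ (ε n • y)) x‖ ≤ ε n * D2 := by
        rw [lap_comp_smul hχs, norm_mul, norm_mul, Complex.norm_real, Real.norm_eq_abs,
          abs_of_nonneg (hε0 n)]
        have h1 : ε n * ‖lap χ (ε n • x)‖ ≤ 1 * D2 := mul_le_mul (hε1 n) (hD2 _) (norm_nonneg _)
          zero_le_one
        rw [one_mul] at h1
        exact mul_le_mul_of_nonneg_left h1 (hε0 n)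
      have hp (i : Fin 2) (D : ℝ) (hD : ∀ x, ‖pd i χ x‖ ≤ D) :
          ‖pd i (fun y => χ (ε n • y)) x‖ ≤ ε n * D := by
        rw [pd_comp_smul, norm_mul, Complex.norm_real, Real.norm_eq_abs, abs_of_nonneg (hε0 n)]
        exact mul_le_mul_of_nonneg_left (hD _) (hε0 n)
      have hp0 := hp 0 D0 hD0
      have hp1 := hp 1 D1 hD1
      have hk := (hC τ x).1
      have hk0 := (hC τ x).2 0
      have hk1 := (hC τ x).2 1
      have hn2 : ‖(2 : ℂ)‖ = 2 := by simp
      rw [norm_mul, Fin.sum_univ_two]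
      have hb : ‖lap (fun y => χ (ε n • y)) x * cohSol z τ x
          + (2 * (pd 0 (fun y => χ (ε n • y)) x * pd 0 (cohSol z τ) x)
            + 2 * (pd 1 (fun y => χ (ε n • y)) x * pd 1 (cohSol z τ) x))‖
          ≤ ε n * D2 * (C * P) + (2 * (ε n * D0 * (C * P)) + 2 * (ε n * D1 * (C * P))) := by
        refine (norm_add_le _ _).trans (add_le_add ?_ ((norm_add_le _ _).trans (add_le_add ?_ ?_)))
        · rw [norm_mul]
          exact mul_le_mul hl hk (norm_nonneg _) (mul_nonneg (hε0 n) hD20)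
        · rw [norm_mul, norm_mul, hn2]
          exact mul_le_mul_of_nonneg_left
            (mul_le_mul hp0 hk0 (norm_nonneg _) (mul_nonneg (hε0 n) hD00)) zero_le_two
        · rw [norm_mul, norm_mul, hn2]
          exact mul_le_mul_of_nonneg_left
            (mul_le_mul hp1 hk1 (norm_nonneg _) (mul_nonneg (hε0 n) hD10)) zero_le_two
      refine (mul_le_mul_of_nonneg_left hb (norm_nonneg _)).trans ?_
      calc _ = ε n * ((D2 + 2 * D0 + 2 * D1) * C) * (‖w τ x‖ * P) := by ring
        _ ≤ _ := mul_le_mul_of_nonneg_left hP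
          (mul_nonneg (hε0 n) (mul_nonneg (by positivity) hC0))
    · rw [integral_const_mul, integral_add (hL τ) integrable_gaussian_half, ← mul_assoc]
      refine le_trans (mul_le_mul_of_nonneg_left (add_le_add_left (hK τ hτ) _)
        (mul_nonneg (mul_nonneg (hε0 n) (by positivity)) hC0)) (le_of_eq (by ring))
  have h0 : Tendsto (fun n => (∫ x, w t x * (χ (ε n • x) * cohSol z t x))
      - ∫ x, w s x * (χ (ε n • x) * cohSol z s x)) atTop (𝓝 0) := by
    refine squeeze_zero_norm hsmall ?_
    have := (hε.mul_const ((D2 + 2 * D0 + 2 * D1) * C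
      * (K + ∫ x : E2, Real.exp (-‖x‖ ^ 2 / 2)))).mul_const |t - s|
    simpa using this
  exact sub_eq_zero.1 (tendsto_nhds_unique ((hlim t).sub (hlim s)) h0)

/-- A lower semicontinuous function on the line that is constant on every interval on which it is
bounded is constant. -/
theorem eq_of_bounded_imp_eq {m : ℝ → ℝ≥0∞} (hfin : ∀ t, m t ≠ ⊤)
    (hcl : ∀ n : ℕ, IsClosed {t | m t ≤ n})
    (hb : ∀ a b : ℝ, (∃ n : ℕ, ∀ τ ∈ Set.uIcc a b, m τ ≤ n) → m a = m b) (s t : ℝ) :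
    m s = m t := by
  set U : Set ℝ := {t | ∃ n : ℕ, ∀ᶠ s in 𝓝 t, m s ≤ n} with hU
  have hUo : IsOpen U := by
    rw [isOpen_iff_mem_nhds]
    rintro x ⟨n, hn⟩
    filter_upwards [eventually_eventually_nhds.2 hn] with y hy using ⟨n, hy⟩
  have hnat : ∀ t, ∃ n : ℕ, m t ≤ n := fun t =>
    ⟨⌈(m t).toNNReal⌉₊, by
      rw [(ENNReal.coe_toNNReal (hfin t)).symm]
      exact_mod_cast Nat.le_ceil _⟩
  have c1 : ∀ a b : ℝ, Set.uIcc a b ⊆ U → m a = m b := by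
    intro a b hab
    apply hb
    refine isCompact_uIcc.induction_on (p := fun S => ∃ n : ℕ, ∀ τ ∈ S, m τ ≤ n) ⟨0, by simp⟩
      (fun S S' h ⟨n, hn⟩ => ⟨n, fun τ hτ => hn τ (h hτ)⟩) ?_ ?_
    · rintro S S' ⟨n, hn⟩ ⟨n', hn'⟩
      refine ⟨max n n', fun τ hτ => ?_⟩
      rcases hτ with h | h
      · exact (hn τ h).trans (by exact_mod_cast le_max_left _ _)
      · exact (hn' τ h).trans (by exact_mod_cast le_max_right _ _)
    · intro x hx
      obtain ⟨n, hn⟩ := hab hx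
      exact ⟨_, mem_nhdsWithin_of_mem_nhds hn, n, fun τ hτ => hτ⟩
  have c2 : ∀ a b : ℝ, (∀ τ ∈ Set.uIcc a b, τ ≠ b → τ ∈ U) → m a = m b := by
    intro a b hab
    apply hb
    obtain ⟨n, hn⟩ := hnat a
    obtain ⟨n', hn'⟩ := hnat b
    refine ⟨max n n', fun τ hτ => ?_⟩
    by_cases h : τ = b
    · rw [h]; exact hn'.trans (by exact_mod_cast le_max_right _ _)
    · have : m a = m τ := by
        refine c1 a τ fun σ hσ => hab σ (Set.uIcc_subset_uIcc_left hτ hσ) ?_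
        rintro rfl
        apply h
        have h1 := Set.mem_uIcc.1 hσ
        have h2 := Set.mem_uIcc.1 hτ
        rcases h1 with h1 | h1 <;> rcases h2 with h2 | h2 <;> apply le_antisymm <;> linarith
      rw [← this]; exact hn.trans (by exact_mod_cast le_max_left _ _)
  suffices hF : Uᶜ = ∅ by
    apply c1
    rw [Set.compl_empty_iff.1 hF]
    exact Set.subset_univ _
  by_contra hne
  have hFc : IsClosed Uᶜ := hUo.isClosed_compl
  have : Nonempty ↥Uᶜ := Set.nonempty_iff_ne_empty.2 hne |>.to_subtype
  have : CompleteSpace ↥Uᶜ := hFc.completeSpace_coe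
  obtain ⟨n, x, hx⟩ := nonempty_interior_of_iUnion_of_closed
    (f := fun n : ℕ => {x : ↥Uᶜ | m x ≤ n}) (fun n => (hcl n).preimage continuous_subtype_val)
    (by ext x; simpa using hnat x)
  obtain ⟨O, hO, hxO⟩ := mem_nhds_subtype _ _ _ |>.1 (mem_interior_iff_mem_nhds.1 hx)
  obtain ⟨δ, hδ, hball⟩ := Metric.mem_nhds_iff.1 hO
  have hIF : ∀ y ∈ Metric.ball (x : ℝ) δ, y ∉ U → m y ≤ n := fun y hy hyU =>
    hxO (a := ⟨y, hyU⟩) (hball hy)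
  apply x.2
  refine ⟨n, ?_⟩
  filter_upwards [Metric.ball_mem_nhds (x : ℝ) hδ] with y hy
  by_cases hyU : y ∈ U
  · have hcomp : IsCompact (Set.uIcc y (x : ℝ) ∩ Uᶜ) := isCompact_uIcc.inter_right hFc
    obtain ⟨b, ⟨hb1, hb2⟩, hb3⟩ := hcomp.exists_isMinOn (f := fun τ => |τ - y|)
      ⟨x, Set.right_mem_uIcc, x.2⟩ (by fun_prop)
    have hyb : m y = m b := by
      apply c2
      intro τ hτ hτb
      by_contra hτU
      apply hτb
      have h1 : |b - y| ≤ |τ - y| := hb3 ⟨Set.uIcc_subset_uIcc_left hb1 hτ, hτU⟩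
      rcases Set.mem_uIcc.1 hτ with h2 | h2
      · rw [abs_of_nonneg (by linarith), abs_of_nonneg (by linarith)] at h1
        linarith
      · rw [abs_of_nonpos (by linarith), abs_of_nonpos (by linarith)] at h1
        linarith
    rw [hyb]
    refine hIF b ?_ hb2
    exact (convex_ball (x : ℝ) δ).ordConnected.uIcc_subset hy (Metric.mem_ball_self hδ) hb1
  · exact hIF y hy hyU

theorem lintegral_sq_eq {f : E2 → ℂ} (hf : Integrable fun x => ‖f x‖ ^ 2) :
    ∫⁻ x, ‖f x‖ₑ ^ 2 = ENNReal.ofReal (∫ x, ‖f x‖ ^ 2) := by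
  rw [ofReal_integral_eq_lintegral_ofReal hf (ae_of_all _ fun x => by positivity)]
  refine lintegral_congr fun x => ?_
  rw [ENNReal.ofReal_pow (norm_nonneg _), ofReal_norm]

theorem schwartz_integrable_sq (f : 𝓢(E2, ℂ)) : Integrable fun x => ‖f x‖ ^ 2 :=
  (f.memLp 2 volume).integrable_norm_pow (by norm_num)

/-- Conservation of mass. -/
theorem LinSol.mass_eq {w : ℝ → 𝓢(E2, ℂ)} (hw : LinSol fun t x => w t x) (s t : ℝ) :
    ∫ x, ‖w s x‖ ^ 2 = ∫ x, ‖w t x‖ ^ 2 := by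
  have hI := fun t => schwartz_integrable_sq (w t)
  have key : ∫⁻ x, ‖w s x‖ₑ ^ 2 = ∫⁻ x, ‖w t x‖ₑ ^ 2 := by
    refine eq_of_bounded_imp_eq (m := fun t => ∫⁻ x, ‖w t x‖ₑ ^ 2) ?_ ?_ ?_ s t
    · intro t
      simp only [lintegral_sq_eq (hI t)]
      exact ENNReal.ofReal_ne_top
    · intro n
      refine IsSeqClosed.isClosed fun τ t hτ ht => ?_
      have hlim : ∀ x, Tendsto (fun k => ‖w (τ k) x‖ₑ ^ 2) atTop (𝓝 (‖w t x‖ₑ ^ 2)) := by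
        intro x
        have h1 := ((continuous_time_slice (G := fun t x => w t x) hw.smooth.continuous x).enorm.tendsto t).comp ht
        exact ((ENNReal.continuous_pow 2).tendsto _).comp h1
      calc ∫⁻ x, ‖w t x‖ₑ ^ 2 = ∫⁻ x, liminf (fun k => ‖w (τ k) x‖ₑ ^ 2) atTop :=
            lintegral_congr fun x => ((hlim x).liminf_eq).symm
        _ ≤ liminf (fun k => ∫⁻ x, ‖w (τ k) x‖ₑ ^ 2) atTop :=
            lintegral_liminf_le fun k => ((w (τ k)).continuous.measurable.enorm.pow_const 2)
        _ ≤ n := liminf_le_of_le (by isBoundedDefault) fun b hb => by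
            obtain ⟨k, hk⟩ := hb.exists
            exact hk.trans (hτ k)
    · rintro a b ⟨n, hn⟩
      symm
      refine mass_eq_of_bargmann (w b) (w a) (2 * (b - a)) (2 * (b - a)) fun z => ?_
      have hp := hw.pairing_eq hI (s := a) (t := b) (K := n) (fun τ hτ => ?_)
        (fun i => Complex.exp (2 * b * I) * z i)
      · unfold cohSol at hp
        have e1 : ∀ i : Fin 2, Complex.exp (-2 * b * I) * (Complex.exp (2 * b * I) * z i) = z i := by
          intro i
          rw [← mul_assoc, ← Complex.exp_add]
          simp
        have e2 : ∀ i : Fin 2, Complex.exp (-2 * a * I) * (Complex.exp (2 * b * I) * z i)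
            = Complex.exp (((2 * (b - a) : ℝ) : ℂ) * I) * z i := by
          intro i
          rw [← mul_assoc, ← Complex.exp_add]
          congr 2; push_cast; ring
        simp_rw [e1, e2, mul_left_comm (w _ _) (Complex.exp _) _] at hp
        rw [integral_const_mul, integral_const_mul] at hp
        have e3 : Complex.exp (((2 * (b - a) : ℝ) : ℂ) * I)
            = Complex.exp (2 * b * I) * Complex.exp (-2 * a * I) := by
          rw [← Complex.exp_add]
          congr 1; push_cast; ring
        rw [e3, mul_assoc, ← e3, ← hp, ← mul_assoc, ← Complex.exp_add]
        simp
      · have := hn τ (Set.uIoc_subset_uIcc hτ)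
        simp only [lintegral_sq_eq (hI τ)] at this
        rw [← ENNReal.ofReal_natCast] at this
        exact (ENNReal.ofReal_le_ofReal_iff (by positivity)).1 this
  rw [lintegral_sq_eq (hI s), lintegral_sq_eq (hI t),
    ENNReal.ofReal_eq_ofReal_iff (by positivity) (by positivity)] at key
  exact key

theorem hasTemperateGrowth_coord (k : Fin 2) : (fun x : E2 => ((x k : ℝ) : ℂ)).HasTemperateGrowth :=
  (Complex.ofRealCLM.comp (EuclideanSpace.proj k : E2 →L[ℝ] ℝ)).hasTemperateGrowth

/-- Annihilation (`σ = 1`) and creation (`σ = -1`) operators with the phase that makes them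
preserve solutions. -/
def ladder (σ : ℝ) (k : Fin 2) (w : ℝ → 𝓢(E2, ℂ)) (t : ℝ) : 𝓢(E2, ℂ) :=
  Complex.exp ((-2 * σ : ℝ) * t * I) •
    (SchwartzMap.smulLeftCLM ℂ (fun x : E2 => ((x k : ℝ) : ℂ)) (w t)
      + (σ : ℂ) • ∂_{EuclideanSpace.single k (1 : ℝ)} (w t))

theorem ladder_apply (σ : ℝ) (k : Fin 2) (w : ℝ → 𝓢(E2, ℂ)) (t : ℝ) (x : E2) :
    ladder σ k w t x = Complex.exp ((-2 * σ : ℝ) * t * I) * (x k * w t x + σ * pd k (w t) x) := by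
  unfold ladder
  simp only [_root_.smul_apply, _root_.add_apply, smul_eq_mul,
    SchwartzMap.smulLeftCLM_apply_apply (hasTemperateGrowth_coord k),
    SchwartzMap.lineDerivOp_apply_eq_fderiv]
  rfl

theorem jsmooth_coord (k : Fin 2) : JSmooth fun _ x => ((x k : ℝ) : ℂ) :=
  (contDiff_coord k).comp contDiff_snd

theorem jsmooth_phase (a : ℝ) : JSmooth fun t _ => Complex.exp (a * t * I) := by
  refine ContDiff.cexp (ContDiff.mul (contDiff_const.mul ?_) contDiff_const)
  exact Complex.ofRealCLM.contDiff.comp contDiff_fst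

theorem JSmooth.mul {f g : ℝ → E2 → ℂ} (hf : JSmooth f) (hg : JSmooth g) :
    JSmooth fun t x => f t x * g t x := ContDiff.mul hf hg

theorem JSmooth.add {f g : ℝ → E2 → ℂ} (hf : JSmooth f) (hg : JSmooth g) :
    JSmooth fun t x => f t x + g t x := ContDiff.add hf hg

theorem jsmooth_const (c : ℂ) : JSmooth fun _ _ => c := contDiff_const

theorem lap_add {f g : E2 → ℂ} (hf : ContDiff ℝ ∞ f) (hg : ContDiff ℝ ∞ g) (x : E2) :
    lap (fun y => f y + g y) x = lap f x + lap g x := by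
  have e : ∀ i, pd i (fun y => f y + g y) = fun y => pd i f y + pd i g y := fun i =>
    funext fun y => pd_add (hf.differentiable (by simp)) (hg.differentiable (by simp)) i y
  unfold lap
  simp_rw [e, fun i => pd_add ((contDiff_pd hf i).differentiable (by simp))
    ((contDiff_pd hg i).differentiable (by simp)) i x, Finset.sum_add_distrib]

theorem lap_const_mul (c : ℂ) {f : E2 → ℂ} (hf : ContDiff ℝ ∞ f) (x : E2) :
    lap (fun y => c * f y) x = c * lap f x := by
  have e : ∀ i, pd i (fun y => c * f y) = fun y => c * pd i f y := fun i =>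
    funext fun y => pd_const_mul c (hf.differentiable (by simp)) i y
  unfold lap
  simp_rw [e, fun i => pd_const_mul c ((contDiff_pd hf i).differentiable (by simp)) i x,
    Finset.mul_sum]

theorem pd_const (c : ℂ) (i : Fin 2) (x : E2) : pd i (fun _ => c) x = 0 := by
  simp [pd]

theorem lap_coord (k : Fin 2) (x : E2) : lap (fun y => ((y k : ℝ) : ℂ)) x = 0 := by
  have e : ∀ i, pd i (fun y => ((y k : ℝ) : ℂ)) = fun _ => if k = i then 1 else 0 := fun i =>
    funext fun y => pd_coord i k y
  unfold lap
  simp_rw [e, pd_const, Finset.sum_const_zero]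

theorem lap_pd {f : E2 → ℂ} (hf : ContDiff ℝ ∞ f) (k : Fin 2) (x : E2) :
    lap (pd k f) x = pd k (lap f) x := by
  have e : lap f = fun y => pd 0 (pd 0 f) y + pd 1 (pd 1 f) y := by
    funext y; simp [lap, Fin.sum_univ_two]
  have e1 : ∀ i, pd i (pd k f) = pd k (pd i f) := fun i => funext fun y => pd_comm hf i k y
  have hs := fun i => (contDiff_pd (contDiff_pd hf i) i).differentiable (by simp)
  rw [e, pd_add (hs 0) (hs 1)]
  simp only [lap, Fin.sum_univ_two, e1]
  rw [pd_comm (contDiff_pd hf 0), pd_comm (contDiff_pd hf 1)]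

theorem norm_sq_cast (x : E2) :
    (‖x‖ : ℂ) ^ 2 = (x 0 : ℂ) * (x 0 : ℂ) + (x 1 : ℂ) * (x 1 : ℂ) := by
  rw [← Complex.ofReal_pow, norm_sq_E2]; push_cast; ring

theorem pd_norm_sq (k : Fin 2) (x : E2) : pd k (fun y => (‖y‖ : ℂ) ^ 2) x = 2 * x k := by
  have hc := fun i => (contDiff_coord i).differentiable (by simp)
  have e : (fun y : E2 => (‖y‖ : ℂ) ^ 2)
      = fun y => (y 0 : ℂ) * (y 0 : ℂ) + (y 1 : ℂ) * (y 1 : ℂ) := funext norm_sq_cast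
  rw [e, pd_add (f := fun y : E2 => (y 0 : ℂ) * (y 0 : ℂ))
    (g := fun y : E2 => (y 1 : ℂ) * (y 1 : ℂ)) ((hc 0).mul (hc 0)) ((hc 1).mul (hc 1)), pd_mul (hc 0) (hc 0),
    pd_mul (hc 1) (hc 1), pd_coord, pd_coord]
  fin_cases k <;> simp <;> ring

theorem contDiff_norm_sq_cast : ContDiff ℝ ∞ fun y : E2 => (‖y‖ : ℂ) ^ 2 := by
  have e : (fun y : E2 => (‖y‖ : ℂ) ^ 2)
      = fun y => (y 0 : ℂ) * (y 0 : ℂ) + (y 1 : ℂ) * (y 1 : ℂ) := funext norm_sq_cast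
  rw [e]
  exact ((contDiff_coord 0).mul (contDiff_coord 0)).add ((contDiff_coord 1).mul (contDiff_coord 1))

theorem LinSol.ladder {w : ℝ → 𝓢(E2, ℂ)} (hw : LinSol fun t x => w t x) {σ : ℝ}
    (hσ : σ * σ = 1) (k : Fin 2) : LinSol fun t x => ladder σ k w t x := by
  have hj := hw.smooth
  refine ⟨?_, fun t x => ?_⟩
  · simp_rw [ladder_apply]
    exact (jsmooth_phase _).mul (((jsmooth_coord k).mul hj).add ((jsmooth_const _).mul (hj.pd k)))
  · have hs : ContDiff ℝ ∞ (w t) := hj.slice t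
    have hd := hs.differentiable (by simp)
    have hck := contDiff_coord k
    have hl := contDiff_lap hs
    have hn := contDiff_norm_sq_cast
    have hlap : lap (_root_.ladder σ k w t) x = Complex.exp ((-2 * σ : ℝ) * t * I) *
        (x k * lap (w t) x + 2 * pd k (w t) x + σ * pd k (lap (w t)) x) := by
      have e : (_root_.ladder σ k w t : E2 → ℂ) = fun y => Complex.exp ((-2 * σ : ℝ) * t * I) *
        (y k * w t y + σ * pd k (w t) y) := funext fun y => ladder_apply σ k w t y
      rw [e, lap_const_mul _ ((hck.mul hs).add (contDiff_const.mul (contDiff_pd hs k))),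
        lap_add (hck.mul hs) (contDiff_const.mul (contDiff_pd hs k)),
        lap_const_mul _ (contDiff_pd hs k), lap_mul hck hs, lap_coord, lap_pd hs]
      simp only [pd_coord]
      simp
      ring
    have hpdt : deriv (fun s => pd k (w s) x) t
        = I * (-pd k (lap (w t)) x + (2 * x k * w t x + (‖x‖ : ℂ) ^ 2 * pd k (w t) x)) := by
      have h1 := hj.deriv_pd k t x
      have e : (fun y => deriv (fun s => w s y) t)
          = fun y => I * ((-1) * lap (w t) y + (‖y‖ : ℂ) ^ 2 * w t y) := by
        funext y
        rw [hw.eq t y]; ring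
      rw [e, pd_const_mul _ (((contDiff_const.mul hl).add (hn.mul hs)).differentiable (by simp)),
        pd_add ((contDiff_const.mul hl).differentiable (by simp))
          ((hn.mul hs).differentiable (by simp)),
        pd_const_mul _ (hl.differentiable (by simp)), pd_mul (hn.differentiable (by simp)) hd,
        pd_norm_sq] at h1
      rw [h1]; ring
    rw [hlap, ladder_apply]
    simp_rw [ladder_apply]
    have hE : HasDerivAt (fun s : ℝ => Complex.exp ((-2 * σ : ℝ) * s * I))
        (Complex.exp ((-2 * σ : ℝ) * t * I) * ((-2 * σ : ℝ) * I)) t := by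
      have := (((hasDerivAt_id (t : ℂ)).const_mul ((-2 * σ : ℝ) : ℂ)).mul_const I).cexp.comp_ofReal
      simpa using this
    have h1 := hj.hasDerivAt t x
    rw [hw.eq t x] at h1
    have h2 := (hj.pd k).hasDerivAt t x
    rw [hpdt] at h2
    have h3 := hE.mul ((h1.const_mul (x k : ℂ)).add (h2.const_mul (σ : ℂ)))
    refine h3.deriv.trans ?_
    simp only [Pi.add_apply]
    have hσ' : (σ : ℂ) * σ = 1 := by exact_mod_cast hσ
    push_cast
    linear_combination (-2 * I * Complex.exp (-2 * σ * t * I) * pd k (w t) x) * hσ'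

/-- Space-time functions built from solutions by algebraic operations. -/
inductive Sp : (ℝ → E2 → ℂ) → Prop
  | sol (w : ℝ → 𝓢(E2, ℂ)) : (LinSol fun t x => w t x) → Sp fun t x => w t x
  | phase (a : ℝ) (c : ℂ) {f : ℝ → E2 → ℂ} : Sp f →
      Sp fun t x => c * Complex.exp (a * t * I) * f t x
  | add {f g : ℝ → E2 → ℂ} : Sp f → Sp g → Sp fun t x => f t x + g t x
  | conj {f : ℝ → E2 → ℂ} : Sp f → Sp fun t x => (starRingEnd ℂ) (f t x)

theorem Sp.congr {f g : ℝ → E2 → ℂ} (hf : Sp f) (h : ∀ t x, f t x = g t x) : Sp g := by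
  have : f = g := by funext t x; exact h t x
  exact this ▸ hf

theorem Sp.const_mul {f : ℝ → E2 → ℂ} (c : ℂ) (hf : Sp f) : Sp fun t x => c * f t x :=
  (Sp.phase 0 c hf).congr fun t x => by simp

theorem Sp.jsmooth {f : ℝ → E2 → ℂ} (hf : Sp f) : JSmooth f := by
  induction hf with
  | sol w hw => exact hw.smooth
  | phase a c _ ih => exact ((jsmooth_const c).mul (jsmooth_phase a)).mul ih
  | add _ _ ihf ihg => exact ihf.add ihg
  | conj _ ih => exact Complex.conjCLE.contDiff.comp ih

theorem pd_conj {f : E2 → ℂ} (hf : Differentiable ℝ f) (i : Fin 2) (x : E2) :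
    pd i (fun y => (starRingEnd ℂ) (f y)) x = (starRingEnd ℂ) (pd i f x) := by
  have h := ((Complex.conjCLE : ℂ ≃L[ℝ] ℂ) : ℂ →L[ℝ] ℂ).hasFDerivAt.comp x (hf x).hasFDerivAt
  unfold pd
  have h2 : fderiv ℝ (fun y => (starRingEnd ℂ) (f y)) x = _ := h.fderiv
  rw [h2]; rfl

theorem Sp.coord_and_pd {f : ℝ → E2 → ℂ} (hf : Sp f) (k : Fin 2) :
    (Sp fun t x => x k * f t x) ∧ Sp fun t x => pd k (f t) x := by
  induction hf with
  | sol w hw =>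
    have h1 := Sp.phase 2 (1 / 2) (Sp.sol _ (hw.ladder (σ := 1) (by norm_num) k))
    have h2 := Sp.phase (-2) (1 / 2) (Sp.sol _ (hw.ladder (σ := -1) (by norm_num) k))
    have e : ∀ t : ℝ, Complex.exp (2 * t * I) * Complex.exp (-(2 * t * I)) = 1 := fun t => by
      rw [← Complex.exp_add]; simp
    constructor
    · refine (h1.add h2).congr fun t x => ?_
      simp only [ladder_apply]
      push_cast
      simp only [neg_mul, mul_neg, mul_one, neg_neg]
      linear_combination ((x k : ℂ) * w t x) * e t
    · refine (h1.add (h2.const_mul (-1))).congr fun t x => ?_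
      simp only [ladder_apply]
      push_cast
      simp only [neg_mul, mul_neg, mul_one, neg_neg]
      linear_combination (pd k (w t) x) * e t
  | phase a c hf ih =>
    refine ⟨(Sp.phase a c ih.1).congr fun t x => by ring,
      (Sp.phase a c ih.2).congr fun t x => ?_⟩
    rw [pd_const_mul _ (hf.jsmooth.diff_slice t)]
  | add hf hg ihf ihg =>
    refine ⟨(ihf.1.add ihg.1).congr fun t x => by ring, (ihf.2.add ihg.2).congr fun t x => ?_⟩
    rw [pd_add (hf.jsmooth.diff_slice t) (hg.jsmooth.diff_slice t)]
  | conj hf ih =>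
    refine ⟨ih.1.conj.congr fun t x => by simp, ih.2.conj.congr fun t x => ?_⟩
    rw [pd_conj (hf.jsmooth.diff_slice t)]

theorem Sp.coord {f : ℝ → E2 → ℂ} (hf : Sp f) (k : Fin 2) : Sp fun t x => x k * f t x :=
  (hf.coord_and_pd k).1

theorem Sp.pd {f : ℝ → E2 → ℂ} (hf : Sp f) (k : Fin 2) : Sp fun t x => pd k (f t) x :=
  (hf.coord_and_pd k).2

theorem norm_add_sq_le (a b : ℂ) : ‖a + b‖ ^ 2 ≤ 2 * ‖a‖ ^ 2 + 2 * ‖b‖ ^ 2 := by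
  have := norm_add_le a b
  nlinarith [norm_nonneg (a + b), norm_nonneg a, norm_nonneg b, sq_nonneg (‖a‖ - ‖b‖)]

theorem Sp.bound {f : ℝ → E2 → ℂ} (hf : Sp f) :
    ∃ B : ℝ, ∀ t, Integrable (fun x => ‖f t x‖ ^ 2) ∧ ∫ x, ‖f t x‖ ^ 2 ≤ B := by
  induction hf with
  | sol w hw =>
    exact ⟨∫ x, ‖w 0 x‖ ^ 2, fun t => ⟨schwartz_integrable_sq _, (hw.mass_eq t 0).le⟩⟩
  | phase a c _ ih =>
    obtain ⟨B, hB⟩ := ih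
    refine ⟨‖c‖ ^ 2 * B, fun t => ?_⟩
    simp only [norm_mul, norm_exp_phase, mul_one, mul_pow]
    refine ⟨(hB t).1.const_mul _, ?_⟩
    rw [integral_const_mul]
    exact mul_le_mul_of_nonneg_left (hB t).2 (by positivity)
  | @add f g hf hg ihf ihg =>
    obtain ⟨B, hB⟩ := ihf
    obtain ⟨B', hB'⟩ := ihg
    refine ⟨2 * B + 2 * B', fun t => ?_⟩
    have hi := ((hB t).1.const_mul 2).add ((hB' t).1.const_mul 2)
    have hle : ∀ x, ‖f t x + g t x‖ ^ 2 ≤ 2 * ‖f t x‖ ^ 2 + 2 * ‖g t x‖ ^ 2 := fun x =>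
      norm_add_sq_le _ _
    have hI : Integrable fun x => ‖f t x + g t x‖ ^ 2 := by
      refine hi.mono' ?_ (ae_of_all _ fun x => ?_)
      · exact (((hf.jsmooth.slice t).continuous.add
          (hg.jsmooth.slice t).continuous).norm.pow 2).aestronglyMeasurable
      · rw [Real.norm_of_nonneg (by positivity)]; exact hle x
    refine ⟨hI, (integral_mono hI hi hle).trans ?_⟩
    simp only [Pi.add_apply]
    rw [integral_add ((hB t).1.const_mul 2) ((hB' t).1.const_mul 2), integral_const_mul,
      integral_const_mul]
    linarith [(hB t).2, (hB' t).2]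
  | conj _ ih =>
    obtain ⟨B, hB⟩ := ih
    exact ⟨B, fun t => by simpa using hB t⟩

theorem IsLinSolution.linSol {w : ℝ → 𝓢(E2, ℂ)} (hw : IsLinSolution w) :
    LinSol fun t x => w t x := by
  refine ⟨hw.1, fun t x => ?_⟩
  have := hw.2 t x
  linear_combination (-I) * this + (deriv (fun s => w s x) t) * I_sq

theorem LinSol.energy_eq {w : ℝ → 𝓢(E2, ℂ)} (hw : LinSol fun t x => w t x) (k : Fin 2) (s t : ℝ) :
    (∫ x, ‖pd k (w s) x‖ ^ 2) + ∫ x, ‖x k * w s x‖ ^ 2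
      = (∫ x, ‖pd k (w t) x‖ ^ 2) + ∫ x, ‖x k * w t x‖ ^ 2 := by
  have key : ∀ τ, (∫ x, ‖_root_.ladder 1 k w τ x‖ ^ 2) + ∫ x, ‖_root_.ladder (-1) k w τ x‖ ^ 2
      = 2 * ((∫ x, ‖pd k (w τ) x‖ ^ 2) + ∫ x, ‖x k * w τ x‖ ^ 2) := by
    intro τ
    obtain ⟨B1, hB1⟩ := ((Sp.sol w hw).pd k).bound
    obtain ⟨B2, hB2⟩ := ((Sp.sol w hw).coord k).bound
    rw [← integral_add (schwartz_integrable_sq _) (schwartz_integrable_sq _),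
      ← integral_add (hB1 τ).1 (hB2 τ).1, ← integral_const_mul]
    refine integral_congr_ae (ae_of_all _ fun x => ?_)
    simp only [ladder_apply, norm_mul (Complex.exp _), norm_exp_phase, one_mul]
    have := parallelogram_law_with_norm ℝ ((x k : ℂ) * w τ x) (pd k (w τ) x)
    push_cast
    rw [one_mul, neg_one_mul, ← sub_eq_add_neg]
    linarith
  have h1 := (hw.ladder (σ := 1) (by norm_num) k).mass_eq s t
  have h2 := (hw.ladder (σ := -1) (by norm_num) k).mass_eq s t
  have h3 := key s
  have h4 := key t
  linarith

theorem LinSol.H1norm_sq {w : ℝ → 𝓢(E2, ℂ)} (hw : LinSol fun t x => w t x) :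
    H1norm (fun z => w 0 z) ^ 2
      = ∑ k, ((∫ x, ‖pd k (w 0) x‖ ^ 2) + ∫ x, ‖x k * w 0 x‖ ^ 2) := by
  have hpd := fun k => ((Sp.sol w hw).pd k).bound.choose_spec 0 |>.1
  have hco := fun k => ((Sp.sol w hw).coord k).bound.choose_spec 0 |>.1
  unfold H1norm
  rw [Real.sq_sqrt]
  · rw [Finset.sum_add_distrib]
    congr 1
    · unfold gradSq
      exact integral_finsetSum _ fun k _ => hpd k
    · rw [← integral_finsetSum _ fun k _ => hco k]
      refine integral_congr_ae (ae_of_all _ fun x => ?_)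
      simp only [norm_mul, mul_pow, Complex.norm_real, Real.norm_eq_abs, sq_abs, Fin.sum_univ_two]
      rw [norm_sq_E2]; ring
  · refine add_nonneg (integral_nonneg fun x => ?_) (integral_nonneg fun x => by positivity)
    exact Finset.sum_nonneg fun k _ => by positivity

theorem LinSol.le_H1norm {w : ℝ → 𝓢(E2, ℂ)} (hw : LinSol fun t x => w t x) (k : Fin 2) (t : ℝ) :
    √(∫ x, ‖pd k (w t) x‖ ^ 2) ≤ H1norm (fun z => w 0 z) ∧
    √(∫ x, ‖x k * w t x‖ ^ 2) ≤ H1norm (fun z => w 0 z) := by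
  have h0 : ∀ j, 0 ≤ ∫ x, ‖pd j (w 0) x‖ ^ 2 := fun j => integral_nonneg fun x => by positivity
  have h1 : ∀ j : Fin 2, 0 ≤ ∫ x, ‖x j * w 0 x‖ ^ 2 := fun j =>
    integral_nonneg fun x => by positivity
  have h2 : (∫ x, ‖pd k (w t) x‖ ^ 2) + ∫ x, ‖x k * w t x‖ ^ 2 ≤ H1norm (fun z => w 0 z) ^ 2 := by
    rw [hw.H1norm_sq, hw.energy_eq k t 0]
    exact Finset.single_le_sum
      (f := fun k => (∫ x, ‖pd k (w 0) x‖ ^ 2) + ∫ x, ‖x k * w 0 x‖ ^ 2)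
      (fun j _ => add_nonneg (h0 j) (h1 j)) (Finset.mem_univ k)
  have h3 : 0 ≤ ∫ x, ‖pd k (w t) x‖ ^ 2 := integral_nonneg fun x => by positivity
  have h4 : 0 ≤ ∫ x, ‖x k * w t x‖ ^ 2 := integral_nonneg fun x => by positivity
  have hN : 0 ≤ H1norm (fun z => w 0 z) := Real.sqrt_nonneg _
  constructor <;> refine Real.sqrt_le_iff.2 ⟨hN, by linarith⟩

theorem LinSol.L2norm_eq {w : ℝ → 𝓢(E2, ℂ)} (hw : LinSol fun t x => w t x) (t : ℝ) :
    L2norm (fun z => w t z) = L2norm (fun z => w 0 z) := by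
  unfold L2norm
  rw [hw.mass_eq t 0]

/-- The time derivative of a solution belongs to the class. -/
theorem LinSol.sp_deriv {w : ℝ → 𝓢(E2, ℂ)} (hw : LinSol fun t x => w t x) :
    Sp fun t x => deriv (fun s => w s x) t := by
  have hS := Sp.sol w hw
  have h1 := ((((hS.pd 0).pd 0).add ((hS.pd 1).pd 1)).const_mul (-1)).add
    (((hS.coord 0).coord 0).add ((hS.coord 1).coord 1))
  refine (h1.const_mul I).congr fun t x => ?_
  rw [hw.eq t x, norm_sq_cast]
  simp only [lap, Fin.sum_univ_two]
  ring

/-- Derivative in the direction `(eₖ, c eₖ)` of a function of two points of the plane. -/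
def dv (c : ℝ) (k : Fin 2) (H : E2 × E2 → ℂ) (p : E2 × E2) : ℂ :=
  fderiv ℝ H p (EuclideanSpace.single k 1, c • EuclideanSpace.single k 1)

theorem dv_add {F G : E2 × E2 → ℂ} (hF : Differentiable ℝ F) (hG : Differentiable ℝ G) (c : ℝ)
    (k : Fin 2) (p : E2 × E2) : dv c k (fun q => F q + G q) p = dv c k F p + dv c k G p := by
  unfold dv
  rw [fderiv_fun_add (hF p) (hG p)]; rfl

theorem dv_mul {F G : E2 × E2 → ℂ} (hF : Differentiable ℝ F) (hG : Differentiable ℝ G) (c : ℝ)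
    (k : Fin 2) (p : E2 × E2) :
    dv c k (fun q => F q * G q) p = dv c k F p * G p + F p * dv c k G p := by
  unfold dv
  rw [fderiv_fun_mul (hF p) (hG p)]
  simp; ring

theorem dv_conj {F : E2 × E2 → ℂ} (hF : Differentiable ℝ F) (c : ℝ) (k : Fin 2) (p : E2 × E2) :
    dv c k (fun q => (starRingEnd ℂ) (F q)) p = (starRingEnd ℂ) (dv c k F p) := by
  have h := ((Complex.conjCLE : ℂ ≃L[ℝ] ℂ) : ℂ →L[ℝ] ℂ).hasFDerivAt.comp p (hF p).hasFDerivAt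
  unfold dv
  have h2 : fderiv ℝ (fun q => (starRingEnd ℂ) (F q)) p = _ := h.fderiv
  rw [h2]; rfl

theorem dv_comm {F : E2 × E2 → ℂ} (hF : ContDiff ℝ ∞ F) (c d : ℝ) (k l : Fin 2) (p : E2 × E2) :
    dv c k (dv d l F) p = dv d l (dv c k F) p := by
  have hW2 : ContDiff ℝ ∞ (fderiv ℝ F) := hF.fderiv_right (m := ∞) le_rfl
  have hd := (hW2.differentiable (by simp)) p
  unfold dv
  rw [fderiv_clm_apply hd (differentiableAt_const _), fderiv_clm_apply hd (differentiableAt_const _)]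
  have hsymm : IsSymmSndFDerivAt ℝ F p := hF.contDiffAt.isSymmSndFDerivAt
    (by rw [minSmoothness_of_isRCLikeNormedField]; exact WithTop.coe_le_coe.2 (le_top : (2 : ℕ∞) ≤ ⊤))
  have := hsymm.eq (EuclideanSpace.single k 1, c • EuclideanSpace.single k 1)
    (EuclideanSpace.single l 1, d • EuclideanSpace.single l 1)
  simpa using this

theorem dv_tensor {f g : E2 → ℂ} (hf : Differentiable ℝ f) (hg : Differentiable ℝ g) (c : ℝ)
    (k : Fin 2) (p : E2 × E2) :
    dv c k (fun q => f q.1 * g q.2) p = pd k f p.1 * g p.2 + c * (f p.1 * pd k g p.2) := by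
  have h1 : HasFDerivAt (fun q : E2 × E2 => f q.1) _ p :=
    (hf p.1).hasFDerivAt.comp p hasFDerivAt_fst
  have h2 : HasFDerivAt (fun q : E2 × E2 => g q.2) _ p :=
    (hg p.2).hasFDerivAt.comp p hasFDerivAt_snd
  unfold dv pd
  have h3 : fderiv ℝ (fun q : E2 × E2 => f q.1 * g q.2) p = _ := (h1.mul h2).fderiv
  rw [h3]
  simp; ring

/-- Finite sums of tensor products of functions of the class `Sp`. -/
inductive Q : (ℝ → E2 × E2 → ℂ) → Prop
  | tensor {f g : ℝ → E2 → ℂ} : Sp f → Sp g → Q fun t p => f t p.1 * g t p.2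
  | add {F G : ℝ → E2 × E2 → ℂ} : Q F → Q G → Q fun t p => F t p + G t p

theorem Q.congr {F G : ℝ → E2 × E2 → ℂ} (hF : Q F) (h : ∀ t p, F t p = G t p) : Q G := by
  have : F = G := by funext t p; exact h t p
  exact this ▸ hF

theorem Q.contDiff {F : ℝ → E2 × E2 → ℂ} (hF : Q F) :
    ContDiff ℝ ∞ fun q : ℝ × (E2 × E2) => F q.1 q.2 := by
  induction hF with
  | tensor hf hg =>
    have h1 : ContDiff ℝ ∞ fun q : ℝ × (E2 × E2) => (q.1, q.2.1) := by fun_prop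
    have h2 : ContDiff ℝ ∞ fun q : ℝ × (E2 × E2) => (q.1, q.2.2) := by fun_prop
    exact (ContDiff.comp hf.jsmooth h1).mul (ContDiff.comp hg.jsmooth h2)
  | add _ _ ih ih' => exact ih.add ih'

theorem Q.slice {F : ℝ → E2 × E2 → ℂ} (hF : Q F) (t : ℝ) : ContDiff ℝ ∞ (F t) :=
  hF.contDiff.comp (contDiff_prodMk_right t)

theorem Q.diff {F : ℝ → E2 × E2 → ℂ} (hF : Q F) (t : ℝ) : Differentiable ℝ (F t) :=
  (hF.slice t).differentiable (by simp)

theorem Q.const_mul {F : ℝ → E2 × E2 → ℂ} (c : ℂ) (hF : Q F) : Q fun t p => c * F t p := by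
  induction hF with
  | tensor hf hg => exact (Q.tensor (hf.const_mul c) hg).congr fun t p => by ring
  | add _ _ ih ih' => exact (ih.add ih').congr fun t p => by ring

theorem Q.coord_fst {F : ℝ → E2 × E2 → ℂ} (hF : Q F) (k : Fin 2) : Q fun t p => p.1 k * F t p := by
  induction hF with
  | tensor hf hg => exact (Q.tensor (hf.coord k) hg).congr fun t p => by ring
  | add _ _ ih ih' => exact (ih.add ih').congr fun t p => by ring

theorem Q.coord_snd {F : ℝ → E2 × E2 → ℂ} (hF : Q F) (k : Fin 2) : Q fun t p => p.2 k * F t p := by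
  induction hF with
  | tensor hf hg => exact (Q.tensor hf (hg.coord k)).congr fun t p => by ring
  | add _ _ ih ih' => exact (ih.add ih').congr fun t p => by ring

theorem Q.dv {F : ℝ → E2 × E2 → ℂ} (hF : Q F) (c : ℝ) (k : Fin 2) :
    Q fun t p => dv c k (F t) p := by
  induction hF with
  | tensor hf hg =>
    refine ((Q.tensor (hf.pd k) hg).add ((Q.tensor hf (hg.pd k)).const_mul c)).congr fun t p => ?_
    rw [dv_tensor (hf.jsmooth.diff_slice t) (hg.jsmooth.diff_slice t)]
  | add hF hG ih ih' =>
    refine (ih.add ih').congr fun t p => ?_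
    rw [dv_add (hF.diff t) (hG.diff t)]

theorem Q.bound {F : ℝ → E2 × E2 → ℂ} (hF : Q F) :
    ∃ B : ℝ, ∀ t, Integrable (fun p => ‖F t p‖ ^ 2) ∧ ∫ p, ‖F t p‖ ^ 2 ≤ B := by
  induction hF with
  | @tensor f g hf hg =>
    obtain ⟨B, hB⟩ := hf.bound
    obtain ⟨B', hB'⟩ := hg.bound
    refine ⟨B * B', fun t => ?_⟩
    simp only [norm_mul, mul_pow]
    refine ⟨(hB t).1.mul_prod (hB' t).1, ?_⟩
    rw [Measure.volume_eq_prod, integral_prod_mul (fun x => ‖f t x‖ ^ 2) (fun x => ‖g t x‖ ^ 2)]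
    have h0 : 0 ≤ ∫ x, ‖f t x‖ ^ 2 := integral_nonneg fun x => by positivity
    exact mul_le_mul (hB t).2 (hB' t).2 (integral_nonneg fun x => by positivity)
      (h0.trans (hB t).2)
  | @add F G hF hG ih ih' =>
    obtain ⟨B, hB⟩ := ih
    obtain ⟨B', hB'⟩ := ih'
    refine ⟨2 * B + 2 * B', fun t => ?_⟩
    have hi := ((hB t).1.const_mul 2).add ((hB' t).1.const_mul 2)
    have hle : ∀ x, ‖F t x + G t x‖ ^ 2 ≤ 2 * ‖F t x‖ ^ 2 + 2 * ‖G t x‖ ^ 2 := fun x =>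
      norm_add_sq_le _ _
    have hI : Integrable fun x => ‖F t x + G t x‖ ^ 2 := by
      refine hi.mono' ?_ (ae_of_all _ fun x => ?_)
      · exact (((hF.slice t).continuous.add
          (hG.slice t).continuous).norm.pow 2).aestronglyMeasurable
      · rw [Real.norm_of_nonneg (by positivity)]; exact hle x
    refine ⟨hI, (integral_mono hI hi hle).trans ?_⟩
    simp only [Pi.add_apply]
    rw [integral_add ((hB t).1.const_mul 2) ((hB' t).1.const_mul 2), integral_const_mul,
      integral_const_mul]
    linarith [(hB t).2, (hB' t).2]

/-- Bounded continuous weights. -/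
structure BddWeight (r : E2 → ℝ) : Prop where
  cont : Continuous r
  bdd : ∃ B : ℝ, ∀ x, |r x| ≤ B

/-- Weighted sesquilinear form of two functions of two points of the plane. -/
def wform (r : E2 → ℝ) (F G : ℝ → E2 × E2 → ℂ) (t : ℝ) (p : E2 × E2) : ℂ :=
  (r (p.1 - p.2) : ℂ) * (F t p * (starRingEnd ℂ) (G t p))

theorem continuous_wform {r : E2 → ℝ} (hr : BddWeight r) {F G : ℝ → E2 × E2 → ℂ} (hF : Q F)
    (hG : Q G) : Continuous fun q : ℝ × (E2 × E2) => wform r F G q.1 q.2 := by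
  unfold wform
  have h1 : Continuous fun q : ℝ × (E2 × E2) => r (q.2.1 - q.2.2) := by
    have := hr.cont
    fun_prop
  exact (Complex.continuous_ofReal.comp h1).mul
    (hF.contDiff.continuous.mul (Complex.continuous_conj.comp hG.contDiff.continuous))

theorem norm_wform_le {r : E2 → ℝ} {B : ℝ} (hB : ∀ x, |r x| ≤ B) (F G : ℝ → E2 × E2 → ℂ)
    (t : ℝ) (p : E2 × E2) : ‖wform r F G t p‖ ≤ B * (‖F t p‖ * ‖G t p‖) := by
  unfold wform
  rw [norm_mul, norm_mul, Complex.norm_real, RCLike.norm_conj]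
  exact mul_le_mul_of_nonneg_right (hB _) (by positivity)

theorem norm_wform_le_sq {r : E2 → ℝ} {B : ℝ} (hB : ∀ x, |r x| ≤ B) (F G : ℝ → E2 × E2 → ℂ)
    (t : ℝ) (p : E2 × E2) : ‖wform r F G t p‖ ≤ B * (‖F t p‖ ^ 2 + ‖G t p‖ ^ 2) := by
  refine (norm_wform_le hB F G t p).trans (mul_le_mul_of_nonneg_left ?_ ((abs_nonneg _).trans (hB 0)))
  nlinarith [sq_nonneg (‖F t p‖ - ‖G t p‖), norm_nonneg (F t p), norm_nonneg (G t p)]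

theorem integrable_wform {r : E2 → ℝ} (hr : BddWeight r) {F G : ℝ → E2 × E2 → ℂ} (hF : Q F)
    (hG : Q G) (t : ℝ) : Integrable (wform r F G t) := by
  obtain ⟨B, hB⟩ := hr.bdd
  obtain ⟨B1, h1⟩ := hF.bound
  obtain ⟨B2, h2⟩ := hG.bound
  refine (((h1 t).1.add (h2 t).1).const_mul B).mono' ?_ (ae_of_all _ fun p => ?_)
  · exact ((continuous_wform hr hF hG).comp (Continuous.prodMk_right t)).aestronglyMeasurable
  · exact norm_wform_le_sq hB F G t p

theorem integrable_uncurry_wform {r : E2 → ℝ} (hr : BddWeight r) {F G : ℝ → E2 × E2 → ℂ}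
    (hF : Q F) (hG : Q G) (s t : ℝ) :
    Integrable (Function.uncurry (wform r F G)) ((volume.restrict (Set.uIoc s t)).prod volume) := by
  have hc : Continuous (Function.uncurry (wform r F G)) := continuous_wform hr hF hG
  have hm : AEStronglyMeasurable (Function.uncurry (wform r F G))
    ((volume.restrict (Set.uIoc s t)).prod volume) := hc.aestronglyMeasurable
  rw [integrable_prod_iff hm]
  refine ⟨ae_of_all _ fun τ => integrable_wform hr hF hG τ, ?_⟩
  obtain ⟨B, hB⟩ := hr.bdd
  obtain ⟨B1, h1⟩ := hF.bound
  obtain ⟨B2, h2⟩ := hG.bound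
  have hB0 : 0 ≤ B := (abs_nonneg _).trans (hB 0)
  have : IsFiniteMeasure (volume.restrict (Set.uIoc s t)) :=
    ⟨by rw [Measure.restrict_apply_univ, Set.uIoc]; exact measure_Ioc_lt_top⟩
  refine Integrable.mono' (g := fun _ => B * (B1 + B2)) (integrable_const _)
    hm.norm.integral_prod_right' (ae_of_all _ fun τ => ?_)
  rw [Real.norm_of_nonneg (integral_nonneg fun p => norm_nonneg _)]
  calc ∫ p, ‖Function.uncurry (wform r F G) (τ, p)‖
      ≤ ∫ p, B * (‖F τ p‖ ^ 2 + ‖G τ p‖ ^ 2) :=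
        integral_mono (integrable_wform hr hF hG τ).norm (((h1 τ).1.add (h2 τ).1).const_mul B)
          fun p => norm_wform_le_sq hB F G τ p
    _ = B * ((∫ p, ‖F τ p‖ ^ 2) + ∫ p, ‖G τ p‖ ^ 2) := by
        rw [integral_const_mul, integral_add (h1 τ).1 (h2 τ).1]
    _ ≤ B * (B1 + B2) := mul_le_mul_of_nonneg_left (add_le_add (h1 τ).2 (h2 τ).2) hB0

theorem dv_weight {r : E2 → ℝ} (hr : Differentiable ℝ r) (c : ℝ) (l : Fin 2) (p : E2 × E2) :
    dv c l (fun q => (r (q.1 - q.2) : ℂ)) p = (1 - c) * (pdR l r (p.1 - p.2) : ℂ) := by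
  have h1 : HasFDerivAt (fun q : E2 × E2 => q.1 - q.2) _ p :=
    (hasFDerivAt_fst (𝕜 := ℝ) (p := p)).sub (hasFDerivAt_snd (𝕜 := ℝ) (p := p))
  have h2 := (hr (p.1 - p.2)).hasFDerivAt.comp p h1
  have h3 := Complex.ofRealCLM.hasFDerivAt.comp p h2
  unfold dv pdR
  have h4 : fderiv ℝ (fun q : E2 × E2 => (r (q.1 - q.2) : ℂ)) p = _ := h3.fderiv
  rw [h4]
  simp
  ring

/-- Integration by parts for the weighted sesquilinear form. -/
theorem integral_wform_dv {r : E2 → ℝ} (hr : ContDiff ℝ 1 r) (hb : BddWeight r) {l : Fin 2}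
    (hb' : BddWeight (pdR l r)) {F G : ℝ → E2 × E2 → ℂ} (hF : Q F) (hG : Q G) (c : ℝ) (t : ℝ) :
    (∫ p, wform r (fun t p => dv c l (F t) p) G t p)
      + (∫ p, wform r F (fun t p => dv c l (G t) p) t p)
      = -(1 - c) * ∫ p, wform (pdR l r) F G t p := by
  have hrd : Differentiable ℝ r := hr.differentiable (by simp)
  have hR : Differentiable ℝ fun q : E2 × E2 => (r (q.1 - q.2) : ℂ) := by
    intro p
    exact (Complex.ofRealCLM.differentiableAt.comp p
      ((hrd (p.1 - p.2)).comp p (differentiableAt_fst.sub differentiableAt_snd)))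
  have hGc : Differentiable ℝ fun q => (starRingEnd ℂ) (G t q) := fun p =>
    ((Complex.conjCLE : ℂ ≃L[ℝ] ℂ) : ℂ →L[ℝ] ℂ).differentiableAt.comp p (hG.diff t p)
  have hRF : Differentiable ℝ fun q : E2 × E2 => (r (q.1 - q.2) : ℂ) * F t q := hR.mul (hF.diff t)
  have e1 : ∀ p, dv c l (fun q => (r (q.1 - q.2) : ℂ) * F t q) p * (starRingEnd ℂ) (G t p)
      = (1 - c) * wform (pdR l r) F G t p + wform r (fun t p => dv c l (F t) p) G t p := by
    intro p
    rw [dv_mul hR (hF.diff t), dv_weight hrd]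
    unfold wform
    ring
  have e2 : ∀ p, (r (p.1 - p.2) : ℂ) * F t p * dv c l (fun q => (starRingEnd ℂ) (G t q)) p
      = wform r F (fun t p => dv c l (G t) p) t p := by
    intro p
    rw [dv_conj (hG.diff t)]
    unfold wform
    ring
  have : (volume : Measure (E2 × E2)).IsAddHaarMeasure := by
    rw [Measure.volume_eq_prod]; infer_instance
  have i1 := (integrable_wform hb' hF hG t).const_mul ((1 : ℂ) - c)
  have i2 := integrable_wform hb (hF.dv c l) hG t
  have i3 := integrable_wform hb hF (hG.dv c l) t
  have i4 := integrable_wform hb hF hG t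
  have := integral_mul_fderiv_eq_neg_fderiv_mul_of_integrable (μ := (volume : Measure (E2 × E2)))
    (f := fun q : E2 × E2 => (r (q.1 - q.2) : ℂ) * F t q) (g := fun q => (starRingEnd ℂ) (G t q))
    (v := (EuclideanSpace.single l (1 : ℝ), c • EuclideanSpace.single l (1 : ℝ)))
    ((i1.add i2).congr (ae_of_all _ fun p => (e1 p).symm))
    (i3.congr (ae_of_all _ fun p => (e2 p).symm))
    (i4.congr (ae_of_all _ fun p => by simp only [wform]; ring))
    (fun x _ => hRF x) (fun x _ => hGc x)
  change ∫ p, (r (p.1 - p.2) : ℂ) * F t p * dv c l (fun q => (starRingEnd ℂ) (G t q)) p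
    = - ∫ p, dv c l (fun q => (r (q.1 - q.2) : ℂ) * F t q) p * (starRingEnd ℂ) (G t p) at this
  simp_rw [e1, e2] at this
  rw [this, integral_add i1 i2, integral_const_mul]
  ring

/-- The two-particle wave function `u(x) conj(v(y))`. -/
def pairFn (u v : ℝ → 𝓢(E2, ℂ)) (t : ℝ) (p : E2 × E2) : ℂ :=
  u t p.1 * (starRingEnd ℂ) (v t p.2)

/-- The time derivative of the two-particle wave function. -/
def pairFnDeriv (u v : ℝ → 𝓢(E2, ℂ)) (t : ℝ) (p : E2 × E2) : ℂ :=
  deriv (fun s => u s p.1) t * (starRingEnd ℂ) (v t p.2)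
    + u t p.1 * (starRingEnd ℂ) (deriv (fun s => v s p.2) t)

section Pair

variable {u v : ℝ → 𝓢(E2, ℂ)}

theorem Q.pairFn (hu : LinSol fun t x => u t x) (hv : LinSol fun t x => v t x) :
    Q (pairFn u v) :=
  Q.tensor (Sp.sol u hu) (Sp.sol v hv).conj

theorem Q.pairFnDeriv (hu : LinSol fun t x => u t x) (hv : LinSol fun t x => v t x) :
    Q (pairFnDeriv u v) :=
  (Q.tensor hu.sp_deriv (Sp.sol v hv).conj).add (Q.tensor (Sp.sol u hu) hv.sp_deriv.conj)

theorem hasDerivAt_conj {f : ℝ → ℂ} {f' : ℂ} {t : ℝ} (hf : HasDerivAt f f' t) :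
    HasDerivAt (fun s => (starRingEnd ℂ) (f s)) ((starRingEnd ℂ) f') t :=
  (((Complex.conjCLE : ℂ ≃L[ℝ] ℂ) : ℂ →L[ℝ] ℂ).hasFDerivAt).comp_hasDerivAt t hf

theorem hasDerivAt_pairFn (hu : LinSol fun t x => u t x) (hv : LinSol fun t x => v t x) (t : ℝ)
    (p : E2 × E2) : HasDerivAt (fun s => pairFn u v s p) (pairFnDeriv u v t p) t :=
  (hu.smooth.hasDerivAt t p.1).mul (hasDerivAt_conj (hv.smooth.hasDerivAt t p.2))

theorem dv_pairFn (hu : LinSol fun t x => u t x) (hv : LinSol fun t x => v t x) (c : ℝ) (k : Fin 2)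
    (t : ℝ) (p : E2 × E2) : dv c k (pairFn u v t) p = pd k (u t) p.1 * (starRingEnd ℂ) (v t p.2)
      + c * (u t p.1 * (starRingEnd ℂ) (pd k (v t) p.2)) := by
  have h := dv_tensor (hu.smooth.diff_slice t) ((Sp.sol v hv).conj.jsmooth.diff_slice t) c k p
  rw [pd_conj (hv.smooth.diff_slice t)] at h
  exact h

theorem hasDerivAt_dv_pairFn (hu : LinSol fun t x => u t x) (hv : LinSol fun t x => v t x)
    (k : Fin 2) (t : ℝ) (p : E2 × E2) :
    HasDerivAt (fun s => dv 1 k (pairFn u v s) p) (dv 1 k (pairFnDeriv u v t) p) t := by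
  have hpu := (hu.smooth.pd k).hasDerivAt t p.1
  have hpv := hasDerivAt_conj ((hv.smooth.pd k).hasDerivAt t p.2)
  rw [hu.smooth.deriv_pd k t] at hpu
  rw [hv.smooth.deriv_pd k t] at hpv
  have h := (hpu.mul (hasDerivAt_conj (hv.smooth.hasDerivAt t p.2))).add
    (((hu.smooth.hasDerivAt t p.1).mul hpv).const_mul ((1 : ℝ) : ℂ))
  have e1 : (fun s => dv 1 k (pairFn u v s) p) = _ := funext fun s => dv_pairFn hu hv 1 k s p
  rw [e1]
  refine h.congr_deriv ?_
  have hud := hu.sp_deriv.jsmooth.diff_slice t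
  have hvd := hv.sp_deriv.jsmooth.diff_slice t
  have hvc := (Sp.sol v hv).conj.jsmooth.diff_slice t
  have hvdc := hv.sp_deriv.conj.jsmooth.diff_slice t
  have h1 := dv_tensor hud hvc 1 k p
  have h2 := dv_tensor (hu.smooth.diff_slice t) hvdc 1 k p
  have h3 := dv_add ((Q.tensor hu.sp_deriv (Sp.sol v hv).conj).diff t)
    ((Q.tensor (Sp.sol u hu) hv.sp_deriv.conj).diff t) 1 k p
  rw [pd_conj (hv.smooth.diff_slice t)] at h1
  rw [pd_conj hvd] at h2
  refine Eq.trans ?_ h3.symm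
  rw [h1, h2]
  simp only [ofReal_one, one_mul]
  ring

theorem dv_dv_pairFn (hu : LinSol fun t x => u t x) (hv : LinSol fun t x => v t x) (k : Fin 2)
    (t : ℝ) (p : E2 × E2) : dv 1 k (dv (-1) k (pairFn u v t)) p
      = pd k (pd k (u t)) p.1 * (starRingEnd ℂ) (v t p.2)
        - u t p.1 * (starRingEnd ℂ) (pd k (pd k (v t)) p.2) := by
  have hU := Sp.sol u hu
  have hV := Sp.sol v hv
  have e : dv (-1) k (pairFn u v t) = fun p => pd k (u t) p.1 * (starRingEnd ℂ) (v t p.2)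
      + (-1) * u t p.1 * (starRingEnd ℂ) (pd k (v t) p.2) := by
    funext p
    rw [dv_pairFn hu hv]
    push_cast
    ring
  have h1 := dv_tensor ((hU.pd k).jsmooth.diff_slice t) (hV.conj.jsmooth.diff_slice t) 1 k p
  have h2 := dv_tensor ((hU.const_mul (-1)).jsmooth.diff_slice t)
    ((hV.pd k).conj.jsmooth.diff_slice t) 1 k p
  have h3 := dv_add ((Q.tensor (hU.pd k) hV.conj).diff t)
    ((Q.tensor (hU.const_mul (-1)) (hV.pd k).conj).diff t) 1 k p
  rw [pd_conj (hV.jsmooth.diff_slice t)] at h1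
  rw [pd_conj ((hV.pd k).jsmooth.diff_slice t), pd_const_mul _ (hU.jsmooth.diff_slice t)] at h2
  rw [e]
  refine h3.trans ?_
  rw [h1, h2]
  simp only [ofReal_one, one_mul]
  ring

/-- The two-particle Schrödinger equation. -/
theorem pairFnDeriv_eq (hu : LinSol fun t x => u t x) (hv : LinSol fun t x => v t x)
    (t : ℝ) (p : E2 × E2) : pairFnDeriv u v t p
      = -I * ((∑ l, dv 1 l (dv (-1) l (pairFn u v t)) p)
        - ((‖p.1‖ : ℂ) ^ 2 - (‖p.2‖ : ℂ) ^ 2) * pairFn u v t p) := by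
  unfold pairFnDeriv
  rw [hu.eq t p.1, hv.eq t p.2]
  simp_rw [dv_dv_pairFn hu hv]
  simp only [lap, pairFn, Fin.sum_univ_two, map_mul, map_add, map_neg, map_pow, conj_I,
    conj_ofReal]
  ring

theorem Q.norm_sq_mul {F : ℝ → E2 × E2 → ℂ} (hF : Q F) :
    Q fun t p => ((‖p.1‖ : ℂ) ^ 2 - (‖p.2‖ : ℂ) ^ 2) * F t p := by
  have h := ((((hF.coord_fst 0).coord_fst 0).add ((hF.coord_fst 1).coord_fst 1))).add
    (((((hF.coord_snd 0).coord_snd 0).add ((hF.coord_snd 1).coord_snd 1))).const_mul (-1))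
  refine h.congr fun t p => ?_
  rw [norm_sq_cast, norm_sq_cast]
  ring

theorem dv_norm_sq_mul {F : E2 × E2 → ℂ} (hF : Differentiable ℝ F) (k : Fin 2) (p : E2 × E2) :
    dv 1 k (fun q => ((‖q.1‖ : ℂ) ^ 2 - (‖q.2‖ : ℂ) ^ 2) * F q) p
      = 2 * (p.1 k - p.2 k) * F p + ((‖p.1‖ : ℂ) ^ 2 - (‖p.2‖ : ℂ) ^ 2) * dv 1 k F p := by
  have hn : Differentiable ℝ fun y : E2 => (‖y‖ : ℂ) ^ 2 :=
    contDiff_norm_sq_cast.differentiable (by simp)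
  have hc : Differentiable ℝ fun _ : E2 => (1 : ℂ) := differentiable_const _
  have hcn : Differentiable ℝ fun _ : E2 => (-1 : ℂ) := differentiable_const _
  have h1 : Differentiable ℝ fun q : E2 × E2 => (‖q.1‖ : ℂ) ^ 2 * (1 : ℂ) :=
    (hn.comp differentiable_fst).mul (differentiable_const _)
  have h2 : Differentiable ℝ fun q : E2 × E2 => (-1 : ℂ) * (‖q.2‖ : ℂ) ^ 2 :=
    (differentiable_const _).mul (hn.comp differentiable_snd)
  have e : (fun q : E2 × E2 => ((‖q.1‖ : ℂ) ^ 2 - (‖q.2‖ : ℂ) ^ 2) * F q)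
      = fun q => ((‖q.1‖ : ℂ) ^ 2 * 1 + (-1) * (‖q.2‖ : ℂ) ^ 2) * F q := by
    funext q; ring
  rw [e, dv_mul (F := fun q : E2 × E2 => (‖q.1‖ : ℂ) ^ 2 * 1 + (-1) * (‖q.2‖ : ℂ) ^ 2)
    (h1.add h2) hF, dv_add h1 h2, dv_tensor hn hc, dv_tensor hcn hn, pd_norm_sq, pd_norm_sq,
    pd_const, pd_const]
  push_cast
  ring

/-- The multiple `(x - y)ₖ F` of a function of two points. -/
theorem Q.rel {F : ℝ → E2 × E2 → ℂ} (hF : Q F) (k : Fin 2) :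
    Q fun t p => (p.1 k - p.2 k : ℂ) * F t p :=
  ((hF.coord_fst k).add ((hF.coord_snd k).const_mul (-1))).congr fun t p => by ring

/-- The virial identity for one component of the weight. -/
theorem integral_virial (hu : LinSol fun t x => u t x) (hv : LinSol fun t x => v t x)
    {r : E2 → ℝ} (hr : ContDiff ℝ 1 r) (hb : BddWeight r) (hb' : ∀ l, BddWeight (pdR l r))
    (k : Fin 2) (t : ℝ) :
    (∫ p, wform r (fun t p => dv 1 k (pairFnDeriv u v t) p) (pairFn u v) t p)
      + (∫ p, wform r (fun t p => dv 1 k (pairFn u v t) p) (pairFnDeriv u v) t p)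
    = I * (-2 * (∑ l, ∫ p, wform (pdR l r) (fun t p => dv 1 k (pairFn u v t) p)
          (fun t p => dv 1 l (pairFn u v t) p) t p)
        + 2 * ∫ p, wform r (fun t p => (p.1 k - p.2 k : ℂ) * pairFn u v t p)
          (pairFn u v) t p) := by
  have hW := Q.pairFn hu hv
  have hWt := Q.pairFnDeriv hu hv
  have hq := hW.norm_sq_mul
  set W := _root_.pairFn u v with hWdef
  set W' := _root_.pairFnDeriv u v with hWdef'
  have b0 := integral_wform_dv hr hb (hb' k) hWt hW 1 t
  have bq := integral_wform_dv hr hb (hb' k) hq hW 1 t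
  have b1 := fun l => integral_wform_dv hr hb (hb' l) (hW.dv 1 k) (hW.dv 1 l) (-1) t
  have b2 := fun l => integral_wform_dv hr hb (hb' l) (hW.dv (-1) l) (hW.dv 1 k) 1 t
  have b3 := fun l => integral_wform_dv hr hb (hb' k) (hW.dv (-1) l) (hW.dv 1 l) 1 t
  simp only [ofReal_one, sub_self, neg_zero, zero_mul] at b0 bq b2 b3
  have iA := integrable_wform hb (hW.dv 1 k) hWt t
  have iB := integrable_wform hb hWt (hW.dv 1 k) t
  have i1 := fun l => integrable_wform hb ((hW.dv 1 k).dv (-1) l) (hW.dv 1 l) t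
  have i1' := fun l => integrable_wform hb (hW.dv 1 k) ((hW.dv 1 l).dv (-1) l) t
  have i2 := fun l => integrable_wform hb ((hW.dv (-1) l).dv 1 l) (hW.dv 1 k) t
  have i2' := fun l => integrable_wform hb (hW.dv (-1) l) ((hW.dv 1 k).dv 1 l) t
  have i3 := fun l => integrable_wform hb ((hW.dv (-1) l).dv 1 k) (hW.dv 1 l) t
  have i3' := fun l => integrable_wform hb (hW.dv (-1) l) ((hW.dv 1 l).dv 1 k) t
  have iq := integrable_wform hb (hq.dv 1 k) hW t
  have iq' := integrable_wform hb hq (hW.dv 1 k) t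
  have iz := integrable_wform hb (hW.rel k) hW t
  have hT := fun l => (((i1 l).add (i1' l)).add ((i2 l).add (i2' l))).sub ((i3 l).add (i3' l))
  have hTint : ∀ l, ∫ p, wform r (fun t => dv (-1) l (dv 1 k (W t))) (fun t => dv 1 l (W t)) t p
      + wform r (fun t => dv 1 k (W t)) (fun t => dv (-1) l (dv 1 l (W t))) t p
      + (wform r (fun t => dv 1 l (dv (-1) l (W t))) (fun t => dv 1 k (W t)) t p
        + wform r (fun t => dv (-1) l (W t)) (fun t => dv 1 l (dv 1 k (W t))) t p)
      - (wform r (fun t => dv 1 k (dv (-1) l (W t))) (fun t => dv 1 l (W t)) t p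
        + wform r (fun t => dv (-1) l (W t)) (fun t => dv 1 k (dv 1 l (W t))) t p)
      = -2 * ∫ p, wform (pdR l r) (fun t p => dv 1 k (W t) p) (fun t p => dv 1 l (W t) p) t p := by
    intro l
    refine (integral_sub (((i1 l).add (i1' l)).add ((i2 l).add (i2' l)))
      ((i3 l).add (i3' l))).trans ?_
    rw [integral_add' ((i1 l).add (i1' l)) ((i2 l).add (i2' l)), integral_add' (i1 l) (i1' l),
      integral_add' (i2 l) (i2' l), integral_add' (i3 l) (i3' l), b1 l, b2 l, b3 l]
    push_cast
    ring
  have key := integral_sub iA iB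
  have key2 : ∀ p, wform r (fun t p => dv 1 k (W t) p) W' t p
        - wform r W' (fun t p => dv 1 k (W t) p) t p
      = I * ((∑ l, (wform r (fun t => dv (-1) l (dv 1 k (W t))) (fun t => dv 1 l (W t)) t p
      + wform r (fun t => dv 1 k (W t)) (fun t => dv (-1) l (dv 1 l (W t))) t p
      + (wform r (fun t => dv 1 l (dv (-1) l (W t))) (fun t => dv 1 k (W t)) t p
        + wform r (fun t => dv (-1) l (W t)) (fun t => dv 1 l (dv 1 k (W t))) t p)
      - (wform r (fun t => dv 1 k (dv (-1) l (W t))) (fun t => dv 1 l (W t)) t p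
        + wform r (fun t => dv (-1) l (W t)) (fun t => dv 1 k (dv 1 l (W t))) t p)))
      + (2 * wform r (fun t p => (p.1 k - p.2 k : ℂ) * W t p) W t p
        - (wform r (fun t => dv 1 k fun p => ((‖p.1‖ : ℂ) ^ 2 - (‖p.2‖ : ℂ) ^ 2) * W t p) W t p
          + wform r (fun t p => ((‖p.1‖ : ℂ) ^ 2 - (‖p.2‖ : ℂ) ^ 2) * W t p)
            (fun t => dv 1 k (W t)) t p))) := by
    intro p
    simp only [wform]
    rw [show W' t p = _ from pairFnDeriv_eq hu hv t p, ← hWdef]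
    rw [dv_norm_sq_mul (hW.diff t)]
    simp only [Fin.sum_univ_two, dv_comm (hW.slice t) 1 (-1), dv_comm (hW.slice t) 1 1 k]
    simp only [map_mul, map_add, map_sub, map_neg, map_pow, conj_I, conj_ofReal]
    ring
  rw [integral_congr_ae (ae_of_all _ key2), integral_const_mul, integral_add, integral_sub,
    integral_finsetSum, integral_const_mul, integral_add] at key
  rotate_left
  · exact iq
  · exact iq'
  · exact fun l _ => hT l
  · exact iz.const_mul 2
  · exact iq.add iq'
  · exact integrable_finsetSum _ fun l _ => hT l
  · exact (iz.const_mul 2).sub (iq.add iq')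
  simp_rw [hTint] at key
  rw [← Finset.mul_sum] at key
  linear_combination (-1 : ℂ) * key + b0 - I * bq

end Pair

theorem norm_single_one (k : Fin 2) : ‖EuclideanSpace.single k (1 : ℝ)‖ = 1 := by simp

theorem contDiff_pdR {n m : WithTop ℕ∞} {ρ : E2 → ℝ} (hρ : ContDiff ℝ n ρ) (h : m + 1 ≤ n)
    (k : Fin 2) : ContDiff ℝ m (pdR k ρ) :=
  (hρ.fderiv_right h).clm_apply contDiff_const

theorem abs_pdR_le {ρ : E2 → ℝ} {B : ℝ} (hB : ∀ x, ‖fderiv ℝ ρ x‖ ≤ B) (k : Fin 2) (x : E2) :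
    |pdR k ρ x| ≤ B := by
  have := (fderiv ℝ ρ x).le_opNorm (EuclideanSpace.single k 1)
  rw [norm_single_one, mul_one] at this
  exact this.trans (hB x)

theorem abs_pdR_pdR_le {ρ : E2 → ℝ} (hρ : ContDiff ℝ 2 ρ) {B : ℝ}
    (hB : ∀ x, ‖iteratedFDeriv ℝ 2 ρ x‖ ≤ B) (l k : Fin 2) (x : E2) :
    |pdR l (pdR k ρ) x| ≤ B := by
  have hd : DifferentiableAt ℝ (fderiv ℝ ρ) x :=
    ((hρ.fderiv_right (m := 1) (by norm_num)).differentiable (by simp)) x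
  have e : pdR l (pdR k ρ) x
      = iteratedFDeriv ℝ 2 ρ x ![EuclideanSpace.single l 1, EuclideanSpace.single k 1] := by
    rw [iteratedFDeriv_two_apply]
    unfold pdR
    rw [fderiv_clm_apply hd (differentiableAt_const _)]
    simp
  rw [e]
  have := (iteratedFDeriv ℝ 2 ρ x).le_opNorm
    ![EuclideanSpace.single l (1 : ℝ), EuclideanSpace.single k (1 : ℝ)]
  simp only [Fin.prod_univ_two, Matrix.cons_val_zero, Matrix.cons_val_one, norm_single_one,
    mul_one] at this
  exact this.trans (hB x)

/-- The Cauchy–Schwarz inequality for functions of the class `Sp`. -/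
theorem Sp.integral_norm_mul_le {f g : ℝ → E2 → ℂ} (hf : Sp f) (hg : Sp g) (t : ℝ) :
    Integrable (fun x => ‖f t x‖ * ‖g t x‖) ∧
    ∫ x, ‖f t x‖ * ‖g t x‖ ≤ √(∫ x, ‖f t x‖ ^ 2) * √(∫ x, ‖g t x‖ ^ 2) := by
  have key : ∀ {f : ℝ → E2 → ℂ}, Sp f → MemLp (fun x => ‖f t x‖) 2 := fun {f} hf => by
    obtain ⟨B, hB⟩ := hf.bound
    refine (memLp_two_iff_integrable_sq ?_).2 (hB t).1
    exact (hf.jsmooth.slice t).continuous.norm.aestronglyMeasurable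
  refine ⟨MemLp.integrable_mul (key hf) (key hg), ?_⟩
  have := integral_mul_le_Lp_mul_Lq_of_nonneg (μ := (volume : Measure E2))
    (f := fun x => ‖f t x‖) (g := fun x => ‖g t x‖) (p := 2) (q := 2)
    Real.HolderConjugate.two_two (ae_of_all _ fun x => norm_nonneg _)
    (ae_of_all _ fun x => norm_nonneg _) (by simpa using key hf) (by simpa using key hg)
  simpa [Real.sqrt_eq_rpow] using this

section Pair

variable {u v : ℝ → 𝓢(E2, ℂ)}

theorem norm_integral_wform_le (hu : LinSol fun t x => u t x) (hv : LinSol fun t x => v t x)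
    {r : E2 → ℝ} {B : ℝ} (hB : ∀ x, |r x| ≤ B) {F : ℝ → E2 × E2 → ℂ}
    {f g : ℝ → E2 → ℂ} (hf : Sp f) (hg : Sp g) {Nu Nv t : ℝ}
    (hfN : √(∫ x, ‖f t x‖ ^ 2) ≤ Nu) (hgN : √(∫ x, ‖g t x‖ ^ 2) ≤ Nv)
    (h : ∀ p, ‖F t p‖ ≤ ‖f t p.1‖ * ‖v t p.2‖ + ‖u t p.1‖ * ‖g t p.2‖) :
    ‖∫ p, wform r F (pairFn u v) t p‖
      ≤ B * (L2norm (fun z => v 0 z) ^ 2 * L2norm (fun z => u 0 z) * Nu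
        + L2norm (fun z => u 0 z) ^ 2 * L2norm (fun z => v 0 z) * Nv) := by
  have hU := Sp.sol u hu
  have hV := Sp.sol v hv
  have hB0 : 0 ≤ B := (abs_nonneg _).trans (hB 0)
  have c1 := hf.integral_norm_mul_le hU t
  have c2 := hV.integral_norm_mul_le hV t
  have c3 := hU.integral_norm_mul_le hU t
  have c4 := hg.integral_norm_mul_le hV t
  have i1 := c1.1.mul_prod c2.1
  have i2 := c3.1.mul_prod c4.1
  have hLu : √(∫ x, ‖u t x‖ ^ 2) = L2norm (fun z => u 0 z) := hu.L2norm_eq t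
  have hLv : √(∫ x, ‖v t x‖ ^ 2) = L2norm (fun z => v 0 z) := hv.L2norm_eq t
  rw [hLu] at c1 c3
  rw [hLv] at c2 c4
  have nLu : 0 ≤ L2norm (fun z => u 0 z) := Real.sqrt_nonneg _
  have nLv : 0 ≤ L2norm (fun z => v 0 z) := Real.sqrt_nonneg _
  have n1 : ∀ f g : E2 → ℂ, 0 ≤ ∫ x, ‖f x‖ * ‖g x‖ := fun f g =>
    integral_nonneg fun x => by positivity
  have d1 := c1.2.trans (mul_le_mul_of_nonneg_right hfN nLu)
  have d4 := c4.2.trans (mul_le_mul_of_nonneg_right hgN nLv)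
  have m1 := mul_le_mul d1 c2.2 (n1 _ _) ((n1 _ _).trans d1)
  have m2 := mul_le_mul c3.2 d4 (n1 _ _) ((n1 _ _).trans c3.2)
  refine (norm_integral_le_of_norm_le ((i1.add i2).const_mul B) (ae_of_all _ fun p => ?_)).trans ?_
  · refine (norm_wform_le hB _ _ t p).trans (mul_le_mul_of_nonneg_left ?_ hB0)
    unfold pairFn
    rw [norm_mul, RCLike.norm_conj]
    refine (mul_le_mul_of_nonneg_right (h p) (by positivity)).trans (le_of_eq ?_)
    simp only [Pi.add_apply]
    ring
  · rw [integral_const_mul]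
    refine mul_le_mul_of_nonneg_left ?_ hB0
    rw [integral_add' i1 i2,
      integral_prod_mul (fun x => ‖f t x‖ * ‖u t x‖) (fun x => ‖v t x‖ * ‖v t x‖),
      integral_prod_mul (fun x => ‖u t x‖ * ‖u t x‖) (fun x => ‖g t x‖ * ‖v t x‖)]
    linarith

theorem integral_integral_virial (hu : LinSol fun t x => u t x) (hv : LinSol fun t x => v t x)
    {r : E2 → ℝ} (hr : ContDiff ℝ 1 r) (hb : BddWeight r) (hb' : ∀ l, BddWeight (pdR l r))
    (k : Fin 2) (s t : ℝ) :
    (∑ l, ∫ τ in s..t, ∫ p, wform (pdR l r) (fun t p => dv 1 k (pairFn u v t) p)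
          (fun t p => dv 1 l (pairFn u v t) p) τ p)
      = (∫ τ in s..t, ∫ p, wform r (fun t p => (p.1 k - p.2 k : ℂ) * pairFn u v t p)
          (pairFn u v) τ p)
        + I / 2 * ((∫ p, wform r (fun t p => dv 1 k (pairFn u v t) p) (pairFn u v) t p)
          - ∫ p, wform r (fun t p => dv 1 k (pairFn u v t) p) (pairFn u v) s p) := by
  have hW := Q.pairFn hu hv
  have hWt := Q.pairFnDeriv hu hv
  have hjoint : ∀ {r : E2 → ℝ} (_ : BddWeight r) {F G : ℝ → E2 × E2 → ℂ} (_ : Q F) (_ : Q G),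
      IntervalIntegrable (fun τ => ∫ p, wform r F G τ p) volume s t := by
    intro r hb F G hF hG
    rw [intervalIntegrable_iff]
    exact (integrable_uncurry_wform hb hF hG s t).integral_prod_left
  have hE := intervalIntegral_integral_eq_sub (μ := (volume : Measure (E2 × E2))) (s := s) (t := t)
    (G := wform r (fun t p => dv 1 k (pairFn u v t) p) (pairFn u v))
    (G' := fun τ p => wform r (fun t p => dv 1 k (pairFnDeriv u v t) p) (pairFn u v) τ p
      + wform r (fun t p => dv 1 k (pairFn u v t) p) (pairFnDeriv u v) τ p)
    (fun p τ => ?_) (fun p => ?_) ?_ (integrable_wform hb (hW.dv 1 k) hW s)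
    (integrable_wform hb (hW.dv 1 k) hW t)
  · rw [← hE]
    have e : ∀ τ, ∫ p, (wform r (fun t p => dv 1 k (pairFnDeriv u v t) p) (pairFn u v) τ p
        + wform r (fun t p => dv 1 k (pairFn u v t) p) (pairFnDeriv u v) τ p)
        = _ := fun τ => (integral_add (integrable_wform hb (hWt.dv 1 k) hW τ)
          (integrable_wform hb (hW.dv 1 k) hWt τ)).trans (integral_virial hu hv hr hb hb' k τ)
    simp_rw [e]
    have j1 := fun l => hjoint (hb' l) (hW.dv 1 k) (hW.dv 1 l)
    have j2 := hjoint hb (hW.rel k) hW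
    rw [intervalIntegral.integral_const_mul, intervalIntegral.integral_add,
      intervalIntegral.integral_const_mul, intervalIntegral.integral_const_mul,
      intervalIntegral.integral_finsetSum]
    · generalize (∑ l, ∫ τ in s..t, ∫ p, wform (pdR l r) (fun t p => dv 1 k (pairFn u v t) p)
          (fun t p => dv 1 l (pairFn u v t) p) τ p) = a
      generalize (∫ τ in s..t, ∫ p, wform r (fun t p => (p.1 k - p.2 k : ℂ) * pairFn u v t p)
          (pairFn u v) τ p) = b
      linear_combination (a - b) * I_sq
    · exact fun l _ => j1 l
    · refine IntervalIntegrable.const_mul ?_ _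
      have := IntervalIntegrable.sum Finset.univ fun l _ => j1 l
      rwa [Finset.sum_fn] at this
    · exact j2.const_mul _
  · unfold wform
    refine (((hasDerivAt_dv_pairFn hu hv k τ p).mul
      (hasDerivAt_conj (hasDerivAt_pairFn hu hv τ p))).const_mul
        (r (p.1 - p.2) : ℂ)).congr_deriv ?_
    ring
  · exact (continuous_time_slice (G := wform r _ _) (continuous_wform hb (hWt.dv 1 k) hW) p).add
      (continuous_time_slice (G := wform r _ _) (continuous_wform hb (hW.dv 1 k) hWt) p)
  · exact (integrable_uncurry_wform hb (hWt.dv 1 k) hW s t).add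
      (integrable_uncurry_wform hb (hW.dv 1 k) hWt s t)

theorem norm_virial_le (hu : LinSol fun t x => u t x) (hv : LinSol fun t x => v t x)
    {r : E2 → ℝ} (hr : ContDiff ℝ 1 r) {B : ℝ} (hB : ∀ x, |r x| ≤ B)
    (hb' : ∀ l, BddWeight (pdR l r)) (k : Fin 2) {T : ℝ} (hT : 0 ≤ T) :
    ‖∑ l, ∫ τ in (0 : ℝ)..T, ∫ p, wform (pdR l r) (fun t p => dv 1 k (pairFn u v t) p)
          (fun t p => dv 1 l (pairFn u v t) p) τ p‖
      ≤ (1 + T) * (B * (L2norm (fun z => v 0 z) ^ 2 * L2norm (fun z => u 0 z)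
          * H1norm (fun z => u 0 z)
        + L2norm (fun z => u 0 z) ^ 2 * L2norm (fun z => v 0 z) * H1norm (fun z => v 0 z))) := by
  have hU := Sp.sol u hu
  have hV := Sp.sol v hv
  rw [integral_integral_virial hu hv hr ⟨hr.continuous, B, hB⟩ hb' k]
  have hM : ∀ t, ‖∫ p, wform r (fun t p => dv 1 k (pairFn u v t) p) (pairFn u v) t p‖ ≤ _ :=
    fun t => norm_integral_wform_le hu hv hB (hU.pd k) (hV.pd k) (hu.le_H1norm k t).1
      (hv.le_H1norm k t).1 fun p => by
        rw [dv_pairFn hu hv]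
        refine (norm_add_le _ _).trans (le_of_eq ?_)
        simp
  have hZ : ∀ t, ‖∫ p, wform r (fun t p => (p.1 k - p.2 k : ℂ) * pairFn u v t p)
      (pairFn u v) t p‖ ≤ _ :=
    fun t => norm_integral_wform_le hu hv hB (hU.coord k) (hV.coord k) (hu.le_H1norm k t).2
      (hv.le_H1norm k t).2 fun p => by
        have e : (p.1 k - p.2 k : ℂ) * pairFn u v t p
          = p.1 k * u t p.1 * (starRingEnd ℂ) (v t p.2)
            - u t p.1 * (p.2 k * (starRingEnd ℂ) (v t p.2)) := by unfold pairFn; ring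
        rw [e]
        refine (norm_sub_le _ _).trans (le_of_eq ?_)
        simp
  have h1 := intervalIntegral.norm_integral_le_of_norm_le_const (a := 0) (b := T)
    (fun t _ => hZ t)
  rw [sub_zero, abs_of_nonneg hT] at h1
  refine (norm_add_le _ _).trans ?_
  rw [norm_mul]
  have h2 := (norm_sub_le (∫ p, wform r (fun t p => dv 1 k (pairFn u v t) p) (pairFn u v) T p)
    (∫ p, wform r (fun t p => dv 1 k (pairFn u v t) p) (pairFn u v) 0 p)).trans
      (add_le_add (hM T) (hM 0))
  have h3 : ‖I / 2‖ = 1 / 2 := by simp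
  rw [h3]
  linarith

end Pair

end Virial

/-- The interaction virial estimate: for two Schwartz-regular solutions `u, v` of the linear
Schrödinger equation with harmonic potential and a `C²` weight `ρ` with bounded first and
second derivatives, setting `aₖ(t,x,y) = conj(v(t,y)) ∂_{xₖ}u(t,x) + u(t,x) ∂_{yₖ}conj(v(t,y))`,
`∫₀ᵀ ∫∫ Σ_{k,l} ∂²_{kl}ρ(x−y) aₖ conj(aₗ) dxdydt
  ≤ C_T ‖∇ρ‖_{L^∞} (‖v(0)‖²_{L²}‖u(0)‖_{L²}‖u(0)‖_{ℋ¹} + ‖u(0)‖²_{L²}‖v(0)‖_{L²}‖v(0)‖_{ℋ¹})`. -/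
theorem interaction_virial_estimate (T : ℝ) (hT : 0 < T) :
    ∃ C : ℝ, 0 < C ∧
      ∀ ρ : E2 → ℝ, ContDiff ℝ 2 ρ →
      (∃ B₂ : ℝ, ∀ x : E2, ‖iteratedFDeriv ℝ 2 ρ x‖ ≤ B₂) →
      ∀ u v : ℝ → SchwartzMap E2 ℂ, IsLinSolution u → IsLinSolution v →
      ∀ Bρ : ℝ, (∀ x : E2, ‖fderiv ℝ ρ x‖ ≤ Bρ) →
      (∫ t in (0:ℝ)..T, ∫ x : E2, ∫ y : E2,
          (∑ k : Fin 2, ∑ l : Fin 2,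
            ((pdR k (pdR l ρ)) (x - y) : ℂ)
              * ((starRingEnd ℂ) (v t y) * pd k (fun z => u t z) x
                  + u t x * pd k (fun z => (starRingEnd ℂ) (v t z)) y)
              * (starRingEnd ℂ) ((starRingEnd ℂ) (v t y) * pd l (fun z => u t z) x
                  + u t x * pd l (fun z => (starRingEnd ℂ) (v t z)) y)).re)
        ≤ C * Bρ *
          (L2norm (fun z => v 0 z)^2 * L2norm (fun z => u 0 z) * H1norm (fun z => u 0 z)
            + L2norm (fun z => u 0 z)^2 * L2norm (fun z => v 0 z)
              * H1norm (fun z => v 0 z)) := by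
  refine ⟨2 * (1 + T), by positivity, ?_⟩
  rintro ρ hρ ⟨B₂, hB₂⟩ u v hu' hv' Bρ hB
  have hu := hu'.linSol
  have hv := hv'.linSol
  have hW := Q.pairFn hu hv
  have hr : ∀ k, ContDiff ℝ 1 (pdR k ρ) := contDiff_pdR hρ (by norm_num)
  have hb' : ∀ k l, BddWeight (pdR l (pdR k ρ)) := fun k l =>
    ⟨(contDiff_pdR (hr k) (m := 0) (by norm_num) l).continuous, B₂, abs_pdR_pdR_le hρ hB₂ l k⟩
  have hbd := fun k => norm_virial_le hu hv (hr k) (abs_pdR_le hB k) (hb' k) k hT.le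
  have hinteg := fun k l => integrable_wform (hb' k l) (hW.dv 1 k) (hW.dv 1 l)
  have hjoint : ∀ k l, IntervalIntegrable (fun τ => ∫ p, wform (pdR l (pdR k ρ))
      (fun t p => dv 1 k (pairFn u v t) p) (fun t p => dv 1 l (pairFn u v t) p) τ p)
      volume 0 T := fun k l => by
    rw [intervalIntegrable_iff]
    exact (integrable_uncurry_wform (hb' k l) (hW.dv 1 k) (hW.dv 1 l) 0 T).integral_prod_left
  have hsum : ∀ t, Integrable fun p => ∑ k, ∑ l, wform (pdR l (pdR k ρ))
      (fun t p => dv 1 k (pairFn u v t) p) (fun t p => dv 1 l (pairFn u v t) p) t p := fun t =>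
    integrable_finsetSum _ fun k _ => integrable_finsetSum _ fun l _ => hinteg k l t
  have hcongr : ∀ t, (∫ x : E2, ∫ y : E2,
          (∑ k : Fin 2, ∑ l : Fin 2,
            ((pdR k (pdR l ρ)) (x - y) : ℂ)
              * ((starRingEnd ℂ) (v t y) * pd k (fun z => u t z) x
                  + u t x * pd k (fun z => (starRingEnd ℂ) (v t z)) y)
              * (starRingEnd ℂ) ((starRingEnd ℂ) (v t y) * pd l (fun z => u t z) x
                  + u t x * pd l (fun z => (starRingEnd ℂ) (v t z)) y)).re)
      = (∑ k, ∑ l, ∫ p, wform (pdR l (pdR k ρ)) (fun t p => dv 1 k (pairFn u v t) p)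
          (fun t p => dv 1 l (pairFn u v t) p) t p).re := by
    intro t
    have e : ∀ x y : E2, (∑ k : Fin 2, ∑ l : Fin 2,
            ((pdR k (pdR l ρ)) (x - y) : ℂ)
              * ((starRingEnd ℂ) (v t y) * pd k (fun z => u t z) x
                  + u t x * pd k (fun z => (starRingEnd ℂ) (v t z)) y)
              * (starRingEnd ℂ) ((starRingEnd ℂ) (v t y) * pd l (fun z => u t z) x
                  + u t x * pd l (fun z => (starRingEnd ℂ) (v t z)) y)).re
        = (∑ k, ∑ l, wform (pdR l (pdR k ρ)) (fun t p => dv 1 k (pairFn u v t) p)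
          (fun t p => dv 1 l (pairFn u v t) p) t (x, y)).re := by
      intro x y
      have ek : ∀ k, (starRingEnd ℂ) (v t y) * pd k (fun z => u t z) x
          + u t x * pd k (fun z => (starRingEnd ℂ) (v t z)) y
          = dv 1 k (pairFn u v t) (x, y) := by
        intro k
        rw [dv_pairFn hu hv, pd_conj (hv.smooth.diff_slice t)]
        push_cast
        ring
      simp_rw [ek]
      unfold wform
      rw [Finset.sum_comm]
      simp only [Complex.re_sum]
      refine Finset.sum_congr rfl fun k _ => Finset.sum_congr rfl fun l _ => ?_
      simp only [mul_re, mul_im, conj_re, conj_im, ofReal_re, ofReal_im]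
      ring
    simp_rw [e]
    have h1 := integral_prod (μ := (volume : Measure E2)) (ν := (volume : Measure E2)) _ (hsum t).re
    have h2 := integral_re (𝕜 := ℂ) (hsum t)
    refine (h1.symm.trans h2).trans ?_
    rw [integral_finsetSum _ fun k _ => integrable_finsetSum _ fun l _ => hinteg k l t]
    simp_rw [fun k => integral_finsetSum Finset.univ fun l _ => hinteg k l t]
    rfl
  simp_rw [hcongr]
  have hre := Complex.reCLM.intervalIntegral_comp_comm (IntervalIntegrable.sum Finset.univ
    fun k _ => IntervalIntegrable.sum Finset.univ fun l _ => hjoint k l)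
  simp only [Finset.sum_apply, Complex.reCLM_apply] at hre
  rw [hre, intervalIntegral.integral_finsetSum fun k _ => ?_]
  · have hk : ∀ k, (∫ τ in (0 : ℝ)..T, ∑ l, ∫ p, wform (pdR l (pdR k ρ))
        (fun t p => dv 1 k (pairFn u v t) p) (fun t p => dv 1 l (pairFn u v t) p) τ p) = _ :=
      fun k => intervalIntegral.integral_finsetSum fun l _ => hjoint k l
    simp_rw [hk]
    refine (Complex.re_le_norm _).trans ((norm_sum_le _ _).trans
      ((Finset.sum_le_sum fun k _ => hbd k).trans (le_of_eq ?_)))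
    simp only [Finset.sum_const, Finset.card_univ, Fintype.card_fin, nsmul_eq_mul]
    push_cast
    ring
  · have := IntervalIntegrable.sum Finset.univ fun l _ => hjoint k l
    rwa [Finset.sum_fn] at this
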